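/- arXiv:1410.4819 — 6 statements merged into one kernel-verified Lean document; each statement's English description precedes it below -/
import Mathlib

section
/- Let P be a finite poset with elements listed as x_1, x_2, …, x_n in a linear extension order (i.e. x_i < x_j in P implies i < j). Then for every order ideal I ∈ J(P), the rowmotion of I satisfies Φ(I) = σ_{x_1} ∘ σ_{x_2} ∘ … ∘ σ_{x_n}(I) (so the toggle at x_n is applied first and the toggle at x_1 last). -/
/-- An order ideal (down-closed subset) of a finite poset, as a `Finset`. -/
def IsIdeal {α : Type*} [PartialOrder α] (I : Finset α) : Prop :=
  ∀ x ∈ I, ∀ y, y ≤ x → y ∈ I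

-- The toggle `σ_x`.
open Classical in
noncomputable def toggle {α : Type*} [PartialOrder α] (x : α) (I : Finset α) : Finset α :=
  if x ∉ I ∧ IsIdeal (insert x I) then insert x I
  else if x ∈ I ∧ IsIdeal (I.erase x) then I.erase x
  else I

-- Rowmotion: `Φ(I)` is the down-set of the minimal elements of the complement of `I`.
open Classical in
noncomputable def rowmotion {α : Type*} [Fintype α] [PartialOrder α] (I : Finset α) :
    Finset α :=
  Finset.univ.filter (fun y => ∃ x : α, x ∉ I ∧ (∀ z : α, z ∉ I → ¬ z < x) ∧ y ≤ x)

theorem IsIdeal.toggle {α : Type*} [PartialOrder α] {K : Finset α} (hK : IsIdeal K) (t : α) :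
    IsIdeal (toggle t K) := by
  unfold _root_.toggle
  split_ifs with h₁ h₂
  · exact h₁.2
  · exact h₂.2
  · exact hK

theorem mem_toggle_of_ne {α : Type*} [PartialOrder α] {t z : α} (h : z ≠ t) (K : Finset α) :
    z ∈ toggle t K ↔ z ∈ K := by
  unfold toggle
  split_ifs <;> simp [h]

theorem mem_toggle_self_of_notMem {α : Type*} [PartialOrder α] {t : α} {K : Finset α}
    (hK : IsIdeal K) (ht : t ∉ K) : t ∈ toggle t K ↔ ∀ y < t, y ∈ K := by
  classical
  have key : IsIdeal (insert t K) ↔ ∀ y < t, y ∈ K := by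
    constructor
    · intro h y hy
      exact Finset.mem_of_mem_insert_of_ne (h t (Finset.mem_insert_self t K) y hy.le) hy.ne
    · intro h z hz y hy
      rcases Finset.mem_insert.1 hz with rfl | hz
      · rcases hy.eq_or_lt with rfl | hy
        · exact Finset.mem_insert_self _ _
        · exact Finset.mem_insert_of_mem (h y hy)
      · exact Finset.mem_insert_of_mem (hK z hz y hy)
  rw [← key]
  unfold toggle
  split_ifs with h₁ h₂
  · simpa using by convert h₁.2
  · exact absurd h₂.1 ht
  · simp only [ht, false_iff]
    intro h
    exact h₁ ⟨ht, by convert h⟩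

theorem mem_toggle_self_of_mem {α : Type*} [PartialOrder α] {t : α} {K : Finset α}
    (hK : IsIdeal K) (ht : t ∈ K) : t ∈ toggle t K ↔ ∃ y ∈ K, t < y := by
  classical
  have key : IsIdeal (K.erase t) ↔ ¬ ∃ y ∈ K, t < y := by
    constructor
    · rintro h ⟨y, hy, hty⟩
      exact Finset.notMem_erase t K (h y (Finset.mem_erase.2 ⟨hty.ne', hy⟩) t hty.le)
    · intro h z hz y hy
      obtain ⟨hzt, hzK⟩ := Finset.mem_erase.1 hz
      refine Finset.mem_erase.2 ⟨?_, hK z hzK y hy⟩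
      rintro rfl
      exact h ⟨z, hzK, lt_of_le_of_ne hy hzt.symm⟩
  rw [← not_iff_not, ← key]
  unfold toggle
  split_ifs with h₁ h₂
  · exact absurd ht h₁.1
  · simpa using by convert h₂.2
  · simp only [ht, not_true, false_iff]
    intro h
    exact h₂ ⟨ht, by convert h⟩

theorem mem_rowmotion {α : Type*} [Fintype α] [PartialOrder α] {I : Finset α} {y : α} :
    y ∈ rowmotion I ↔ ∃ x, x ∉ I ∧ (∀ z, z ∉ I → ¬ z < x) ∧ y ≤ x := by
  simp [rowmotion]

theorem mem_rowmotion_of_notMem {α : Type*} [Fintype α] [PartialOrder α] {I : Finset α} {t : α}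
    (ht : t ∉ I) : t ∈ rowmotion I ↔ ∀ y < t, y ∈ I := by
  rw [mem_rowmotion]
  constructor
  · rintro ⟨x, -, hmin, htx⟩ y hy
    by_contra hyI
    exact hmin y hyI (hy.trans_le htx)
  · intro h
    exact ⟨t, ht, fun z hz hzt => hz (h z hzt), le_rfl⟩

theorem mem_rowmotion_of_mem {α : Type*} [Fintype α] [PartialOrder α] {I : Finset α} {t : α}
    (ht : t ∈ I) : t ∈ rowmotion I ↔ ∃ y ∈ rowmotion I, t < y := by
  simp only [mem_rowmotion]
  constructor
  · rintro ⟨x, hx, hmin, htx⟩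
    exact ⟨x, ⟨x, hx, hmin, le_rfl⟩, lt_of_le_of_ne htx fun h => hx (h ▸ ht)⟩
  · rintro ⟨y, ⟨x, hx, hmin, hyx⟩, hty⟩
    exact ⟨x, hx, hmin, hty.le.trans hyx⟩

/-- Toggling an up-closed set of elements, from the top down, replaces the ideal by its rowmotion
on that set and leaves it unchanged elsewhere. -/
theorem foldr_toggle_spec {α : Type*} [Fintype α] [PartialOrder α] {I : Finset α}
    (hI : IsIdeal I) (L : List α) (hL : L.Pairwise fun a b => ¬ b < a) (hnd : L.Nodup)
    (hup : ∀ a ∈ L, ∀ b, a ≤ b → b ∈ L) :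
    IsIdeal (L.foldr (fun t K => toggle t K) I) ∧
      (∀ z ∈ L, z ∈ L.foldr (fun t K => toggle t K) I ↔ z ∈ rowmotion I) ∧
      ∀ z ∉ L, z ∈ L.foldr (fun t K => toggle t K) I ↔ z ∈ I := by
  induction L with
  | nil => simpa using hI
  | cons t L ih =>
    obtain ⟨htL, hL⟩ := List.pairwise_cons.1 hL
    obtain ⟨htn, hnd⟩ := List.nodup_cons.1 hnd
    have hup' : ∀ a ∈ L, ∀ b, a ≤ b → b ∈ L := by
      intro a ha b hab
      rcases List.mem_cons.1 (hup a (List.mem_cons_of_mem t ha) b hab) with rfl | hb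
      · rcases hab.eq_or_lt with rfl | hab
        · exact ha
        · exact absurd hab (htL a ha)
      · exact hb
    obtain ⟨hK, hin, hout⟩ := ih hL hnd hup'
    rw [List.foldr_cons]
    generalize L.foldr (fun t K => toggle t K) I = K at hK hin hout ⊢
    have habove : ∀ y, t < y → y ∈ L := fun y hy =>
      (List.mem_cons.1 (hup t List.mem_cons_self y hy.le)).resolve_left hy.ne'
    have hbelow : ∀ y, y < t → y ∉ L := fun y hy hyL => htn (hup' y hyL t hy.le)
    refine ⟨hK.toggle t, fun z hz => ?_, fun z hz => ?_⟩
    · by_cases hzt : z = t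
      · subst hzt
        by_cases hzI : z ∈ I
        · rw [mem_toggle_self_of_mem hK ((hout z htn).2 hzI), mem_rowmotion_of_mem hzI]
          exact exists_congr fun y => and_congr_left fun hy => hin y (habove y hy)
        · rw [mem_toggle_self_of_notMem hK (mt (hout z htn).1 hzI), mem_rowmotion_of_notMem hzI]
          exact forall₂_congr fun y hy => hout y (hbelow y hy)
      · rw [mem_toggle_of_ne hzt, hin z ((List.mem_cons.1 hz).resolve_left hzt)]
    · obtain ⟨hzt, hzL⟩ := not_or.1 (mt List.mem_cons.2 hz)
      rw [mem_toggle_of_ne hzt, hout z hzL]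

/-- if `x_1, …, x_n` is a linear extension of a finite poset, then rowmotion
equals the composite of toggles `σ_{x_1} ∘ σ_{x_2} ∘ … ∘ σ_{x_n}` (toggle at `x_n` first). -/
theorem stmt_1 {α : Type*} [Fintype α] [PartialOrder α] (n : ℕ) (x : Fin n → α)
    (hbij : Function.Bijective x) (hlin : ∀ i j : Fin n, x i < x j → i < j)
    (I : Finset α) (hI : IsIdeal I) :
    rowmotion I = List.foldr (fun t K => toggle t K) I (List.ofFn x) := by
  have hmem : ∀ z, z ∈ List.ofFn x := fun z => (List.mem_ofFn' x z).2 (hbij.2 z)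
  obtain ⟨-, hin, -⟩ := foldr_toggle_spec hI (List.ofFn x)
    (List.pairwise_ofFn.2 fun i j hij hlt => (hlin j i hlt).asymm hij)
    (List.nodup_ofFn.2 hbij.1) fun _ _ b _ => hmem b
  ext z
  exact (hin z (hmem z)).symm
end

section
/- Let a, b ≥ 1. Define α : J(Q_{a,b}) → S_{a,a+b} by α(I) = (α_1(I), …, α_a(I)) where α_j(I) = |C_{a+1−j}(I)| + j for 1 ≤ j ≤ a. Then α is a well-defined bijection from J(Q_{a,b}) onto S_{a,a+b}, and for every I ∈ J(Q_{a,b}) and every 1 ≤ j ≤ a, α(σ_{C_j}(I)) = W_{a+1−j}(α(I)). -/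
-- The poset `Q_{a,b}` is represented as `Fin a × Fin b` with the componentwise
-- (product) order; the 0-based pair `(i, j)` represents the 1-based `(i+1, j+1)`.

-- `colCard I i = |C_{i+1}(I)|`: the number of elements of `I` in (0-based) column `i`.
def colCard {a b : ℕ} (I : Finset (Fin a × Fin b)) (i : Fin a) : ℕ :=
  (I.filter (fun p => p.1 = i)).card

-- The column toggle `σ_{C_i}`, toggling the elements of column `i` from the topmost
-- down to the bottommost.
noncomputable def colToggle {a b : ℕ} (i : Fin a) (I : Finset (Fin a × Fin b)) :
    Finset (Fin a × Fin b) :=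
  List.foldr (fun (j : Fin b) K => toggle (i, j) K) I (List.ofFn (fun j : Fin b => j))

-- Comotion `T_ν = σ_{C_{ν(a)}} ∘ … ∘ σ_{C_{ν(1)}}` (so `σ_{C_{ν(1)}}` is applied first).
noncomputable def comotion {a b : ℕ} (ν : Equiv.Perm (Fin a)) (I : Finset (Fin a × Fin b)) :
    Finset (Fin a × Fin b) :=
  List.foldl (fun K t => colToggle (ν t) K) I (List.ofFn (fun t : Fin a => t))
-- The set `S_{k,m}` of strictly increasing `k`-tuples with entries in `{1, …, m}`.
def Smem (k m : ℕ) (x : Fin k → ℕ) : Prop :=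
  StrictMono x ∧ ∀ i, 1 ≤ x i ∧ x i ≤ m

-- Extension of a tuple by the boundary conventions `x_0 = 0`, `x_{k+1} = m+1`
-- (1-based indexing: `extS k m x j` is `x_j`).
def extS (k m : ℕ) (x : Fin k → ℕ) (j : ℕ) : ℕ :=
  if h : 1 ≤ j ∧ j ≤ k then x ⟨j - 1, by omega⟩ else if j = 0 then 0 else m + 1

-- Winching at (0-based) index `i`:  `y_i = x_i + 1` if `x_i + 1 < x_{i+1}`, else `y_i = x_{i-1} + 1`.
def winch (k m : ℕ) (i : Fin k) (x : Fin k → ℕ) : Fin k → ℕ := fun j =>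
  if j = i then
    (if x i + 1 < extS k m x (i.val + 2) then x i + 1 else extS k m x i.val + 1)
  else x j

-- `W_ν = W_{ν(k)} ∘ … ∘ W_{ν(1)}` (so `W_{ν(1)}` is applied first).
def winchPerm (k m : ℕ) (ν : Equiv.Perm (Fin k)) (x : Fin k → ℕ) : Fin k → ℕ :=
  List.foldl (fun y t => winch k m (ν t) y) x (List.ofFn (fun t : Fin k => t))

-- The bijection `α : J(Q_{a,b}) → S_{a,a+b}`, `α_j(I) = |C_{a+1−j}(I)| + j` (1-based `j`);
-- in 0-based indexing, `α(I) j = |C_{j.rev}(I)| + j + 1`.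
def alphaMap (a b : ℕ) (I : Finset (Fin a × Fin b)) : Fin a → ℕ := fun j =>
  colCard I j.rev + j.val + 1

/-- The set of cells of `Fin a × Fin b` lying below the height function `h`. -/
def belowHeights {a b : ℕ} (h : Fin a → ℕ) : Finset (Fin a × Fin b) :=
  Finset.univ.filter (fun p => p.2.val < h p.1)

theorem mem_belowHeights {a b : ℕ} {h : Fin a → ℕ} {p : Fin a × Fin b} :
    p ∈ belowHeights h ↔ p.2.val < h p.1 := by
  simp [belowHeights]

theorem colCard_eq_card {a b : ℕ} (I : Finset (Fin a × Fin b)) (i : Fin a) :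
    colCard I i = (Finset.univ.filter (fun j : Fin b => (i, j) ∈ I)).card := by
  unfold colCard
  refine Finset.card_bij' (fun p _ => p.2) (fun j _ => (i, j)) ?_ ?_ ?_ ?_
  · rintro ⟨x, y⟩ hp
    simp only [Finset.mem_filter, Finset.mem_univ, true_and] at hp ⊢
    exact hp.2 ▸ hp.1
  · intro j hj
    simpa using hj
  · rintro ⟨x, y⟩ hp
    simp only [Finset.mem_filter] at hp
    simp [hp.2]
  · intro j _
    rfl

theorem colCard_le {a b : ℕ} (I : Finset (Fin a × Fin b)) (i : Fin a) : colCard I i ≤ b := by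
  rw [colCard_eq_card]
  exact (Finset.card_le_univ _).trans_eq (Fintype.card_fin b)

theorem colCard_belowHeights {a b : ℕ} {h : Fin a → ℕ} {i : Fin a} (hi : h i ≤ b) :
    colCard (belowHeights h : Finset (Fin a × Fin b)) i = h i := by
  rw [colCard_eq_card]
  simp only [mem_belowHeights]
  rw [Fin.card_filter_val_lt, min_eq_right hi]

theorem IsIdeal.belowHeights_colCard {a b : ℕ} {I : Finset (Fin a × Fin b)} (hI : IsIdeal I) :
    belowHeights (colCard I) = I := by
  ext ⟨i, j⟩
  rw [mem_belowHeights, colCard_eq_card]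
  constructor
  · contrapose!
    intro hj
    refine (Finset.card_le_card (t := Finset.Iio j) fun k hk => ?_).trans_eq (Fin.card_Iio j)
    rw [Finset.mem_Iio]
    by_contra hjk
    exact hj (hI _ (Finset.mem_filter.1 hk).2 _ ⟨le_rfl, not_lt.1 hjk⟩)
  · intro hj
    have : (Finset.Iic j).card ≤ (Finset.univ.filter (fun j : Fin b => (i, j) ∈ I)).card := by
      refine Finset.card_le_card fun k hk => ?_
      simp only [Finset.mem_filter, Finset.mem_univ, true_and]
      exact hI _ hj _ ⟨le_rfl, Finset.mem_Iic.1 hk⟩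
    rw [Fin.card_Iic] at this
    exact this

theorem IsIdeal.antitone_colCard {a b : ℕ} {I : Finset (Fin a × Fin b)} (hI : IsIdeal I) :
    Antitone (colCard I) := by
  intro i k hik
  rw [colCard_eq_card, colCard_eq_card]
  refine Finset.card_le_card fun j hj => ?_
  simp only [Finset.mem_filter, Finset.mem_univ, true_and] at hj ⊢
  exact hI _ hj _ ⟨hik, le_rfl⟩

theorem isIdeal_belowHeights_iff {a b : ℕ} {h : Fin a → ℕ} (hb : ∀ i, h i ≤ b) :
    IsIdeal (belowHeights h : Finset (Fin a × Fin b)) ↔ Antitone h := by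
  constructor
  · intro hI i k hik
    simpa [colCard_belowHeights, hb] using hI.antitone_colCard hik
  · rintro hh ⟨i, j⟩ hx ⟨k, l⟩ ⟨hk, hl⟩
    rw [mem_belowHeights] at hx ⊢
    exact (Fin.le_def.1 hl).trans_lt (hx.trans_le (hh hk))

theorem insert_belowHeights {a b : ℕ} {h : Fin a → ℕ} {i : Fin a} {j : Fin b}
    (hj : h i = j) :
    insert (i, j) (belowHeights h) = belowHeights (Function.update h i (j + 1)) := by
  ext ⟨k, l⟩
  rw [Finset.mem_insert, mem_belowHeights, mem_belowHeights, Prod.mk.injEq]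
  by_cases hk : k = i
  · subst hk
    simp only [Function.update_self, Fin.ext_iff, true_and]
    omega
  · simp [hk]

theorem erase_belowHeights {a b : ℕ} {h : Fin a → ℕ} {i : Fin a} {j : Fin b}
    (hj : h i = j + 1) :
    (belowHeights h).erase (i, j) = belowHeights (Function.update h i j) := by
  ext ⟨k, l⟩
  rw [Finset.mem_erase, mem_belowHeights, mem_belowHeights, Ne, Prod.mk.injEq]
  by_cases hk : k = i
  · subst hk
    simp only [Function.update_self, Fin.ext_iff, true_and]
    omega
  · simp [hk]

/-- The effect of toggling the cell at height `j` on the height `v` of its column, when the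
neighbouring columns allow precisely the heights from `L` to `U`. -/
def heightToggle (L U j v : ℕ) : ℕ :=
  if v = j ∧ j < U then j + 1 else if v = j + 1 ∧ L ≤ j then j else v

theorem heightToggle_mem {L U j v : ℕ} (hv : L ≤ v ∧ v ≤ U) :
    L ≤ heightToggle L U j v ∧ heightToggle L U j v ≤ U := by
  unfold heightToggle
  split_ifs <;> omega

theorem foldr_heightToggle_range {L U : ℕ} (n v : ℕ) (hL : L ≤ v) (hU : v ≤ U) :
    (List.range n).foldr (heightToggle L U) v =
      if n < v then v else if v = n then L else if v < U then v + 1 else L := by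
  induction n generalizing v with
  | zero =>
    simp only [List.range_zero, List.foldr_nil]
    split_ifs <;> omega
  | succ n ih =>
    have hm := heightToggle_mem (j := n) ⟨hL, hU⟩
    rw [List.range_succ, List.foldr_append, List.foldr_cons, List.foldr_nil, ih _ hm.1 hm.2]
    unfold heightToggle
    split_ifs <;> omega

open Classical in
theorem toggle_eq_ite {α : Type*} [PartialOrder α] [d : DecidableEq α] (x : α) (I : Finset α) :
    toggle x I = if x ∉ I ∧ IsIdeal (insert x I) then insert x I
      else if x ∈ I ∧ IsIdeal (I.erase x) then I.erase x else I := by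
  obtain rfl : d = fun a b => propDecidable (a = b) := Subsingleton.elim _ _
  rfl

theorem toggle_belowHeights {a b : ℕ} {h : Fin a → ℕ} (hb : ∀ i, h i ≤ b) {i : Fin a} {L U : ℕ}
    (hLU : ∀ v ≤ b, Antitone (Function.update h i v) ↔ L ≤ v ∧ v ≤ U)
    (hi : L ≤ h i ∧ h i ≤ U) (j : Fin b) :
    toggle (i, j) (belowHeights h) =
      belowHeights (Function.update h i (heightToggle L U j (h i))) := by
  have hle : ∀ v ≤ b, ∀ k, Function.update h i v k ≤ b := by
    intro v hv k
    by_cases hk : k = i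
    · subst hk
      simpa using hv
    · simpa [hk] using hb k
  have hins : ((i, j) ∉ belowHeights h ∧ IsIdeal (insert (i, j) (belowHeights h))) ↔
      h i = j ∧ j < U := by
    constructor
    · rintro ⟨hn, hI⟩
      rw [mem_belowHeights, not_lt] at hn
      have hij : h i = j := by
        by_contra hne
        have hlt : h i < j := lt_of_le_of_ne hn hne
        have hm := hI (i, j) (Finset.mem_insert_self _ _) (i, ⟨h i, hlt.trans j.2⟩)
          ⟨le_rfl, Fin.le_def.2 hn⟩
        rw [Finset.mem_insert, mem_belowHeights] at hm
        rcases hm with hm | hm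
        · exact hlt.ne (congrArg Fin.val (Prod.mk.inj hm).2)
        · exact lt_irrefl _ hm
      rw [insert_belowHeights hij, isIdeal_belowHeights_iff (hle _ j.2), hLU _ j.2] at hI
      exact ⟨hij, hI.2⟩
    · rintro ⟨hij, hU⟩
      rw [insert_belowHeights hij, isIdeal_belowHeights_iff (hle _ j.2), hLU _ j.2,
        mem_belowHeights]
      dsimp only
      omega
  have hera : ((i, j) ∈ belowHeights h ∧ IsIdeal ((belowHeights h).erase (i, j))) ↔
      h i = j + 1 ∧ L ≤ j := by
    constructor
    · rintro ⟨hm, hI⟩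
      rw [mem_belowHeights] at hm
      have hij : h i = j + 1 := by
        by_contra hne
        have hlt : j + 1 < h i := lt_of_le_of_ne hm (Ne.symm hne)
        refine Finset.notMem_erase (i, j) (belowHeights h) (hI (i, ⟨j + 1, hlt.trans_le (hb i)⟩) ?_ _
          ⟨le_rfl, Fin.le_def.2 (Nat.le_succ _)⟩)
        rw [Finset.mem_erase, mem_belowHeights]
        exact ⟨by simp [Fin.ext_iff], hlt⟩
      rw [erase_belowHeights hij, isIdeal_belowHeights_iff (hle _ j.2.le), hLU _ j.2.le] at hI
      exact ⟨hij, hI.1⟩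
    · rintro ⟨hij, hL⟩
      rw [erase_belowHeights hij, isIdeal_belowHeights_iff (hle _ j.2.le), hLU _ j.2.le,
        mem_belowHeights]
      dsimp only
      omega
  rw [toggle_eq_ite, heightToggle]
  simp only [hins, hera]
  split_ifs with h1 h2
  · exact insert_belowHeights h1.1
  · exact erase_belowHeights h2.1
  · rw [Function.update_eq_self]

theorem foldr_toggle_belowHeights {a b : ℕ} {h : Fin a → ℕ} (hb : ∀ i, h i ≤ b) {i : Fin a}
    {L U : ℕ} (hU : U ≤ b) (hLU : ∀ v ≤ b, Antitone (Function.update h i v) ↔ L ≤ v ∧ v ≤ U)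
    (hi : L ≤ h i ∧ h i ≤ U) (l : List (Fin b)) :
    ∃ v, v = (l.map Fin.val).foldr (heightToggle L U) (h i) ∧ (L ≤ v ∧ v ≤ U) ∧
      l.foldr (fun j K => toggle (i, j) K) (belowHeights h) =
        belowHeights (Function.update h i v) := by
  induction l with
  | nil => exact ⟨h i, rfl, hi, by rw [Function.update_eq_self]; rfl⟩
  | cons j l ih =>
    obtain ⟨v, hv, hm, hf⟩ := ih
    refine ⟨heightToggle L U j v, by rw [hv]; rfl, heightToggle_mem hm, ?_⟩
    rw [List.foldr_cons, hf, toggle_belowHeights (L := L) (U := U)]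
    · simp
    · intro k
      by_cases hk : k = i
      · subst hk
        simpa using hm.2.trans hU
      · simpa [hk] using hb k
    · simpa using hLU
    · simpa using hm

theorem colToggle_belowHeights {a b : ℕ} {h : Fin a → ℕ} (hb : ∀ i, h i ≤ b) {i : Fin a}
    {L U : ℕ} (hU : U ≤ b) (hLU : ∀ v ≤ b, Antitone (Function.update h i v) ↔ L ≤ v ∧ v ≤ U)
    (hi : L ≤ h i ∧ h i ≤ U) :
    colToggle i (belowHeights h : Finset (Fin a × Fin b)) =
      belowHeights (Function.update h i (if h i < U then h i + 1 else L)) := by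
  obtain ⟨v, hv, -, hf⟩ := foldr_toggle_belowHeights hb hU hLU hi (List.finRange b)
  have hl : List.ofFn (fun j : Fin b => j) = List.finRange b := List.ofFn_id b
  unfold colToggle
  rw [hl, hf]
  rw [List.map_coe_finRange_eq_range, foldr_heightToggle_range _ _ hi.1 hi.2] at hv
  congr 2
  rw [hv]
  have := hb i
  split_ifs <;> omega

theorem antitone_update_iff {a b : ℕ} {h : Fin a → ℕ} (hh : Antitone h) (i : Fin a) {v : ℕ}
    (hv : v ≤ b) :
    Antitone (Function.update h i v) ↔
      (if hs : i.val + 1 < a then h ⟨i + 1, hs⟩ else 0) ≤ v ∧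
        v ≤ if 0 < i.val then h ⟨i - 1, by omega⟩ else b := by
  constructor
  · intro ht
    constructor
    · split_ifs with hs
      · have := ht (a := i) (b := ⟨i + 1, hs⟩) (Fin.le_def.2 (Nat.le_succ _))
        rwa [Function.update_self, Function.update_of_ne (by simp [Fin.ext_iff])] at this
      · exact Nat.zero_le _
    · split_ifs with hs
      · have := ht (a := ⟨i - 1, by omega⟩) (b := i) (Fin.le_def.2 (Nat.sub_le _ _))
        rwa [Function.update_self,
          Function.update_of_ne (by simp only [ne_eq, Fin.ext_iff]; omega)] at this
      · exact hv
  · rintro ⟨hL, hU⟩ k l hkl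
    rw [Fin.le_def] at hkl
    by_cases hk : k = i <;> by_cases hl : l = i
    · rw [hk, hl]
    · subst hk
      rw [Function.update_self, Function.update_of_ne hl]
      rw [Fin.ext_iff] at hl
      rw [dif_pos (by omega)] at hL
      exact (hh (Fin.le_def.2 (by dsimp only; omega))).trans hL
    · subst hl
      rw [Function.update_self, Function.update_of_ne hk]
      rw [Fin.ext_iff] at hk
      rw [if_pos (by omega)] at hU
      exact hU.trans (hh (Fin.le_def.2 (by dsimp only; omega)))
    · rw [Function.update_of_ne hk, Function.update_of_ne hl]
      exact hh (Fin.le_def.2 hkl)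

theorem StrictMono.fin_add_sub_le {n : ℕ} {y : Fin n → ℕ} (hy : StrictMono y) {i j : Fin n}
    (hij : i ≤ j) : y i + (j - i : ℕ) ≤ y j := by
  obtain ⟨j, hj⟩ := j
  rw [Fin.le_def] at hij
  dsimp only at hij ⊢
  induction j, hij using Nat.le_induction with
  | base => simp
  | succ k hk ih =>
    have h1 := ih (by omega)
    have h2 : y ⟨k, by omega⟩ < y ⟨k + 1, hj⟩ := hy (Fin.lt_def.2 (Nat.lt_succ_self _))
    omega

theorem smem_alphaMap {a b : ℕ} {I : Finset (Fin a × Fin b)} (hI : IsIdeal I) :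
    Smem a (a + b) (alphaMap a b I) := by
  constructor
  · intro i j hij
    have h1 := hI.antitone_colCard (Fin.rev_le_rev.2 hij.le)
    rw [Fin.lt_def] at hij
    unfold alphaMap
    omega
  · intro i
    have h1 := colCard_le I i.rev
    unfold alphaMap
    omega

theorem injOn_alphaMap (a b : ℕ) :
    Set.InjOn (alphaMap a b) {I : Finset (Fin a × Fin b) | IsIdeal I} := by
  intro I hI J hJ hIJ
  have hc : colCard I = colCard J := by
    funext i
    have := congrFun hIJ i.rev
    simp only [alphaMap, Fin.rev_rev] at this
    omega
  rw [← IsIdeal.belowHeights_colCard hI, hc, IsIdeal.belowHeights_colCard hJ]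

theorem exists_isIdeal_alphaMap_eq {a b : ℕ} {y : Fin a → ℕ} (hy : Smem a (a + b) y) :
    ∃ I : Finset (Fin a × Fin b), IsIdeal I ∧ alphaMap a b I = y := by
  obtain ⟨hm, hr⟩ := hy
  have hlow : ∀ i : Fin a, i.val + 1 ≤ y i := fun i => by
    have h1 := hm.fin_add_sub_le (i := ⟨0, i.pos⟩) (j := i) (Fin.le_def.2 (Nat.zero_le _))
    have h2 := hr ⟨0, i.pos⟩
    dsimp only at h1
    omega
  have hupp : ∀ i : Fin a, y i ≤ b + i.val + 1 := fun i => by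
    have hi := i.2
    have h1 := hm.fin_add_sub_le (i := i) (j := ⟨a - 1, by omega⟩)
      (Fin.le_def.2 (by dsimp only; omega))
    have h2 := hr ⟨a - 1, by omega⟩
    dsimp only at h1
    omega
  have hb : ∀ i : Fin a, y i.rev - (i.rev.val + 1) ≤ b := fun i => by
    have := hupp i.rev
    omega
  refine ⟨belowHeights fun i => y i.rev - (i.rev.val + 1), ?_, ?_⟩
  · rw [isIdeal_belowHeights_iff hb]
    intro i j hij
    have hle := Fin.rev_le_rev.2 hij
    have h1 := hm.fin_add_sub_le hle
    rw [Fin.le_def] at hle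
    dsimp only
    omega
  · funext i
    have := hlow i
    rw [alphaMap, colCard_belowHeights (hb _)]
    simp only [Fin.rev_rev]
    omega

theorem alphaMap_colToggle {a b : ℕ} {I : Finset (Fin a × Fin b)} (hI : IsIdeal I) (j : Fin a) :
    alphaMap a b (colToggle j I) = winch a (a + b) j.rev (alphaMap a b I) := by
  have hb := colCard_le I
  have hh := hI.antitone_colCard
  have hLU := fun v (hv : v ≤ b) => antitone_update_iff hh j hv
  have hi := (hLU (colCard I j) (hb j)).1 (by rwa [Function.update_eq_self])
  have hU : (if 0 < j.val then colCard I ⟨j - 1, by omega⟩ else b) ≤ b := by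
    split_ifs
    · exact hb _
    · exact le_rfl
  have hct := colToggle_belowHeights hb hU hLU hi
  rw [hI.belowHeights_colCard] at hct
  have hj := j.2
  have hnext : extS a (a + b) (alphaMap a b I) (j.rev.val + 2) =
      (if 0 < j.val then colCard I ⟨j - 1, by omega⟩ else b) + j.rev.val + 2 := by
    unfold extS
    rw [Fin.val_rev]
    by_cases h0 : 0 < j.val
    · rw [dif_pos (by omega), if_pos h0, alphaMap]
      have : (⟨a - (j + 1) + 2 - 1, by omega⟩ : Fin a).rev = ⟨j - 1, by omega⟩ := by
        rw [Fin.ext_iff, Fin.val_rev]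
        dsimp only
        omega
      rw [this]
      dsimp only
      omega
    · rw [dif_neg (by omega), if_neg (by omega), if_neg h0]
      omega
  have hprev : extS a (a + b) (alphaMap a b I) j.rev.val =
      (if hs : j.val + 1 < a then colCard I ⟨j + 1, hs⟩ else 0) + j.rev.val := by
    unfold extS
    rw [Fin.val_rev]
    by_cases hs : j.val + 1 < a
    · rw [dif_pos (by omega), dif_pos hs, alphaMap]
      have : (⟨a - (j + 1) - 1, by omega⟩ : Fin a).rev = ⟨j + 1, hs⟩ := by
        rw [Fin.ext_iff, Fin.val_rev]
        dsimp only
        omega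
      rw [this]
      dsimp only
      omega
    · rw [dif_neg (by omega), if_pos (by omega), dif_neg hs]
      omega
  have hv : (if colCard I j < if 0 < j.val then colCard I ⟨j - 1, by omega⟩ else b then
      colCard I j + 1 else if hs : j.val + 1 < a then colCard I ⟨j + 1, hs⟩ else 0) ≤ b := by
    split_ifs at hi hU ⊢ <;> omega
  funext k
  unfold winch
  rw [hnext, hprev, hct]
  generalize (if 0 < j.val then colCard I ⟨j - 1, by omega⟩ else b) = U at *
  generalize (if hs : j.val + 1 < a then colCard I ⟨j + 1, hs⟩ else 0) = L at *
  by_cases hk : k = j.rev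
  · subst hk
    rw [if_pos rfl, alphaMap, Fin.rev_rev, colCard_belowHeights (by simpa using hv),
      Function.update_self, alphaMap, Fin.rev_rev]
    split_ifs <;> omega
  · have hkj : k.rev ≠ j := fun hkj => hk (by rw [← hkj, Fin.rev_rev])
    rw [if_neg hk, alphaMap, colCard_belowHeights (by simpa [hkj] using hb _),
      Function.update_of_ne hkj, alphaMap]

/-- `α` is a bijection from the order ideals of `Q_{a,b}` onto `S_{a,a+b}`,
and it intertwines the column toggle `σ_{C_j}` with winching `W_{a+1−j}`
(in 0-based indexing, column `j` corresponds to winching index `j.rev`). -/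
theorem stmt_2 (a b : ℕ) (ha : 1 ≤ a) (hb : 1 ≤ b) :
    Set.BijOn (alphaMap a b) {I : Finset (Fin a × Fin b) | IsIdeal I}
      {y : Fin a → ℕ | Smem a (a + b) y} ∧
    ∀ I : Finset (Fin a × Fin b), IsIdeal I → ∀ j : Fin a,
      alphaMap a b (colToggle j I) = winch a (a + b) j.rev (alphaMap a b I) :=
  ⟨⟨fun _ hI => smem_alphaMap hI, injOn_alphaMap a b, fun _ hy => exists_isIdeal_alphaMap_eq hy⟩,
    fun _ hI j => alphaMap_colToggle hI j⟩
end

section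
/- Let a ≥ 1 and take lower bounds l_j = 2j−1 for 1 ≤ j ≤ a. Define β : J(U_a) → S'_{a,2a} by β(I) = (β_1(I), …, β_a(I)) where β_j(I) = |C_{a+1−j}(I)| + 2j − 1. Then β is a well-defined bijection from J(U_a) onto S'_{a,2a}, and for every I ∈ J(U_a) and every 1 ≤ j ≤ a, β(σ_{C_j}(I)) = W̲_{a+1−j}(β(I)). -/
-- The poset `U_a` (the "upper lattice"): the subposet of `[a] × [a]` of pairs `(i, j)`
-- with `i ≥ a+1−j`.  In 0-based coordinates `(i, j) : Fin a × Fin a` this condition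
-- reads `a ≤ i + j + 1`; the order is inherited (componentwise).
abbrev Ua (a : ℕ) := {p : Fin a × Fin a // a ≤ p.1.val + p.2.val + 1}

-- `colCardU I i = |C_{i+1}(I)|`: the number of elements of `I` in (0-based) column `i`.
def colCardU {a : ℕ} (I : Finset (Ua a)) (i : Fin a) : ℕ :=
  (I.filter (fun p => p.1.1 = i)).card

-- The column toggle `σ_{C_i}` on `J(U_a)`, toggling the elements of column `i` from the
-- topmost down to the bottommost.
noncomputable def colToggleU {a : ℕ} (i : Fin a) (I : Finset (Ua a)) : Finset (Ua a) :=
  List.foldr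
    (fun (j : Fin a) K =>
      if h : a ≤ i.val + j.val + 1 then toggle (⟨(i, j), h⟩ : Ua a) K else K)
    I (List.ofFn (fun j : Fin a => j))

-- Comotion `T_ν = σ_{C_{ν(a)}} ∘ … ∘ σ_{C_{ν(1)}}` on `J(U_a)`.
noncomputable def comotionU {a : ℕ} (ν : Equiv.Perm (Fin a)) (I : Finset (Ua a)) :
    Finset (Ua a) :=
  List.foldl (fun K t => colToggleU (ν t) K) I (List.ofFn (fun t : Fin a => t))
-- Winching with lower bounds `l` at index `i`: replace the `i`-th entry of `W_i(x)`
-- by `max((W_i(x))_i, l_i)`.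
def winchL (k m : ℕ) (l : Fin k → ℕ) (i : Fin k) (x : Fin k → ℕ) : Fin k → ℕ := fun j =>
  if j = i then max (winch k m i x i) (l i) else x j

-- `W̲_ν = W̲_{ν(k)} ∘ … ∘ W̲_{ν(1)}` (so `W̲_{ν(1)}` is applied first).
def winchLPerm (k m : ℕ) (l : Fin k → ℕ) (ν : Equiv.Perm (Fin k)) (x : Fin k → ℕ) :
    Fin k → ℕ :=
  List.foldl (fun y t => winchL k m l (ν t) y) x (List.ofFn (fun t : Fin k => t))

-- The bijection `β : J(U_a) → S'_{a,2a}`, `β_j(I) = |C_{a+1−j}(I)| + 2j − 1` (1-based `j`);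
-- in 0-based indexing, `β(I) j = |C_{j.rev}(I)| + 2j + 1`.
def betaMap (a : ℕ) (I : Finset (Ua a)) : Fin a → ℕ := fun j =>
  colCardU I j.rev + 2 * j.val + 1

lemma toggle_of_insert {α : Type*} [PartialOrder α] [DecidableEq α] {x : α} {I : Finset α}
    (hx : x ∉ I) (h : IsIdeal (insert x I)) : toggle x I = insert x I := by
  obtain rfl : ‹DecidableEq α› = fun a b => Classical.propDecidable (a = b) :=
    Subsingleton.elim _ _
  exact if_pos ⟨hx, h⟩

lemma toggle_of_erase {α : Type*} [PartialOrder α] [DecidableEq α] {x : α} {I : Finset α}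
    (hx : x ∈ I) (h : IsIdeal (I.erase x)) : toggle x I = I.erase x := by
  obtain rfl : ‹DecidableEq α› = fun a b => Classical.propDecidable (a = b) :=
    Subsingleton.elim _ _
  rw [toggle, if_neg fun H => H.1 hx, if_pos ⟨hx, h⟩]

lemma toggle_of_not_isIdeal {α : Type*} [PartialOrder α] [DecidableEq α] {x : α}
    {I : Finset α} (hinsert : x ∉ I → ¬ IsIdeal (insert x I))
    (herase : x ∈ I → ¬ IsIdeal (I.erase x)) : toggle x I = I := by
  obtain rfl : ‹DecidableEq α› = fun a b => Classical.propDecidable (a = b) :=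
    Subsingleton.elim _ _
  rw [toggle, if_neg fun H => hinsert H.1 H.2, if_neg fun H => herase H.1 H.2]

/-- The subset of `U_a` consisting of the lowest `c i` elements of each column `i`. -/
def idealOfHeights {a : ℕ} (c : Fin a → ℕ) : Finset (Ua a) :=
  Finset.univ.filter fun p => p.1.1.val + p.1.2.val + 1 < a + c p.1.1

/-- The column heights that come from an order ideal of `U_a`. -/
def IsHeights {a : ℕ} (c : Fin a → ℕ) : Prop :=
  (∀ i, c i ≤ i.val + 1) ∧ ∀ i i' : Fin a, i'.val = i.val + 1 → c i' ≤ c i + 1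

lemma mem_idealOfHeights {a : ℕ} (c : Fin a → ℕ) (p : Ua a) :
    p ∈ idealOfHeights c ↔ p.1.1.val + p.1.2.val + 1 < a + c p.1.1 := by
  simp [idealOfHeights]

lemma IsHeights.apply_le_add_of_val_eq_add {a : ℕ} {c : Fin a → ℕ} (hc : IsHeights c)
    (i : Fin a) :
    ∀ (n : ℕ) (i' : Fin a), i'.val = i.val + n → c i' ≤ c i + n := by
  intro n
  induction n with
  | zero =>
    intro i' h
    obtain rfl : i' = i := Fin.ext h
    omega
  | succ n ih =>
    intro i' h
    have h1 := ih ⟨i.val + n, by omega⟩ rfl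
    have h2 := hc.2 ⟨i.val + n, by omega⟩ i' (by simp only; omega)
    omega

lemma IsHeights.isIdeal {a : ℕ} {c : Fin a → ℕ} (hc : IsHeights c) :
    IsIdeal (idealOfHeights c) := by
  rintro ⟨⟨i, j⟩, hx⟩ hmem ⟨⟨i', j'⟩, hy⟩ hle
  have hle' : i' ≤ i ∧ j' ≤ j := hle
  rw [mem_idealOfHeights] at *
  have h1 : i'.val ≤ i.val := hle'.1
  have h2 : j'.val ≤ j.val := hle'.2
  have h3 := hc.apply_le_add_of_val_eq_add i' (i.val - i'.val) i (by omega)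
  simp only at *
  omega

lemma isHeights_of_isIdeal {a : ℕ} {c : Fin a → ℕ} (hb : ∀ i, c i ≤ i.val + 1)
    (h : IsIdeal (idealOfHeights c)) : IsHeights c := by
  refine ⟨hb, fun i i' hi => ?_⟩
  by_contra! hlt
  have hb' := hb i'
  have := h ⟨(i', ⟨a + c i' - i'.val - 2, by omega⟩), by simp only; omega⟩
    (by rw [mem_idealOfHeights]; simp only; omega)
    ⟨(i, ⟨a + c i' - i'.val - 2, by omega⟩), by simp only; omega⟩
    (show i ≤ i' ∧ _ from ⟨by rw [Fin.le_def]; omega, le_rfl⟩)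
  rw [mem_idealOfHeights] at this
  simp only at this
  omega

lemma exists_heights {a : ℕ} {I : Finset (Ua a)} (hI : IsIdeal I) :
    ∃ c : Fin a → ℕ, IsHeights c ∧ I = idealOfHeights c := by
  let c : Fin a → ℕ := fun i =>
    (I.filter fun p => p.1.1 = i).sup fun p => p.1.1.val + p.1.2.val + 2 - a
  have hIc : I = idealOfHeights c := by
    ext p
    rw [mem_idealOfHeights]
    constructor
    · intro hp
      have : p.1.1.val + p.1.2.val + 2 - a ≤ c p.1.1 :=
        Finset.le_sup (f := fun p : Ua a => p.1.1.val + p.1.2.val + 2 - a)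
          (Finset.mem_filter.2 ⟨hp, rfl⟩)
      have := p.2
      omega
    · intro hp
      have hlt : p.1.1.val + p.1.2.val + 1 - a < c p.1.1 := by
        have := p.2
        omega
      obtain ⟨q, hq, hpq⟩ := Finset.lt_sup_iff.1 hlt
      obtain ⟨hqI, hq1⟩ := Finset.mem_filter.1 hq
      have := p.2
      rw [hq1] at hpq
      exact hI q hqI p
        (show p.1.1 ≤ q.1.1 ∧ p.1.2 ≤ q.1.2 from ⟨hq1.ge, by rw [Fin.le_def]; omega⟩)
  have hb : ∀ i, c i ≤ i.val + 1 := fun i => Finset.sup_le fun p hp => by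
    have := congrArg Fin.val (Finset.mem_filter.1 hp).2
    omega
  exact ⟨c, isHeights_of_isIdeal hb (hIc ▸ hI), hIc⟩

lemma colCardU_idealOfHeights {a : ℕ} {c : Fin a → ℕ} (i : Fin a) (hb : c i ≤ i.val + 1) :
    colCardU (idealOfHeights c) i = c i := by
  rw [colCardU]
  conv_rhs => rw [← Finset.card_range (c i)]
  refine Finset.card_bij (fun p _ => p.1.1.val + p.1.2.val + 1 - a) ?_ ?_ ?_
  · rintro ⟨⟨i', j⟩, h⟩ hp
    simp only [Finset.mem_filter, mem_idealOfHeights] at hp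
    obtain ⟨hp, rfl⟩ := hp
    rw [Finset.mem_range]
    dsimp only at hp h ⊢
    omega
  · rintro ⟨⟨i₁, j₁⟩, h₁⟩ hp₁ ⟨⟨i₂, j₂⟩, h₂⟩ hp₂ heq
    obtain rfl : i₁ = i := (Finset.mem_filter.1 hp₁).2
    obtain rfl : i₂ = i₁ := (Finset.mem_filter.1 hp₂).2
    dsimp only at heq h₁ h₂
    obtain rfl : j₁ = j₂ := Fin.ext (by omega)
    rfl
  · intro k hk
    rw [Finset.mem_range] at hk
    refine ⟨⟨(i, ⟨a + k - i.val - 1, by omega⟩), by simp only; omega⟩, ?_, ?_⟩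
    · simp only [Finset.mem_filter, mem_idealOfHeights, and_true]
      omega
    · simp only
      omega

lemma betaMap_idealOfHeights {a : ℕ} {c : Fin a → ℕ} (hc : IsHeights c) (j : Fin a) :
    betaMap a (idealOfHeights c) j = c j.rev + 2 * j.val + 1 := by
  rw [betaMap, colCardU_idealOfHeights _ (hc.1 _)]

lemma insert_idealOfHeights {a : ℕ} (c : Fin a → ℕ) (i j : Fin a)
    (h : a ≤ i.val + j.val + 1) (hj : i.val + j.val + 1 = a + c i) :
    insert (⟨(i, j), h⟩ : Ua a) (idealOfHeights c) =
      idealOfHeights (Function.update c i (c i + 1)) := by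
  ext ⟨⟨i', j'⟩, h'⟩
  simp only [Finset.mem_insert, mem_idealOfHeights, Subtype.mk.injEq, Prod.mk.injEq]
  by_cases hi : i' = i
  · subst hi
    simp only [Function.update_self, true_and, Fin.ext_iff]
    omega
  · simp [hi]

lemma erase_idealOfHeights {a : ℕ} (c : Fin a → ℕ) (i j : Fin a)
    (h : a ≤ i.val + j.val + 1) (hj : i.val + j.val + 2 = a + c i) :
    (idealOfHeights c).erase (⟨(i, j), h⟩ : Ua a) =
      idealOfHeights (Function.update c i (c i - 1)) := by
  ext ⟨⟨i', j'⟩, h'⟩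
  simp only [Finset.mem_erase, mem_idealOfHeights, ne_eq, Subtype.mk.injEq, Prod.mk.injEq]
  by_cases hi : i' = i
  · subst hi
    simp only [Function.update_self, true_and, Fin.ext_iff]
    omega
  · simp [hi]

lemma toggle_eq_of_addable {a : ℕ} {c : Fin a → ℕ} (i j : Fin a)
    (h : a ≤ i.val + j.val + 1) (hj : i.val + j.val + 1 = a + c i)
    (hadd : IsHeights (Function.update c i (c i + 1))) :
    toggle (⟨(i, j), h⟩ : Ua a) (idealOfHeights c) =
      idealOfHeights (Function.update c i (c i + 1)) := by
  have hins := insert_idealOfHeights c i j h hj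
  rw [← hins]
  refine toggle_of_insert ?_ (hins ▸ hadd.isIdeal)
  rw [mem_idealOfHeights]
  simp only
  omega

lemma toggle_eq_of_removable {a : ℕ} {c : Fin a → ℕ} (i j : Fin a)
    (h : a ≤ i.val + j.val + 1) (hj : i.val + j.val + 2 = a + c i)
    (hrem : IsHeights (Function.update c i (c i - 1))) :
    toggle (⟨(i, j), h⟩ : Ua a) (idealOfHeights c) =
      idealOfHeights (Function.update c i (c i - 1)) := by
  have hmem : (⟨(i, j), h⟩ : Ua a) ∈ idealOfHeights c := by
    rw [mem_idealOfHeights]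
    simp only
    omega
  have her := erase_idealOfHeights c i j h hj
  rw [← her]
  exact toggle_of_erase hmem (her ▸ hrem.isIdeal)

lemma toggle_eq_self {a : ℕ} {c : Fin a → ℕ} (hc : IsHeights c) (i j : Fin a)
    (h : a ≤ i.val + j.val + 1)
    (hadd : i.val + j.val + 1 = a + c i → ¬ IsHeights (Function.update c i (c i + 1)))
    (hrem : i.val + j.val + 2 = a + c i → ¬ IsHeights (Function.update c i (c i - 1))) :
    toggle (⟨(i, j), h⟩ : Ua a) (idealOfHeights c) = idealOfHeights c := by
  have bound : ∀ v, v ≤ i.val + 1 → ∀ t, Function.update c i v t ≤ t.val + 1 := by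
    intro v hv t
    by_cases ht : t = i
    · subst ht
      simpa using hv
    · simpa [ht] using hc.1 t
  refine toggle_of_not_isIdeal ?_ ?_
  · intro hmem hid
    rw [mem_idealOfHeights] at hmem
    simp only at hmem
    by_cases hj : i.val + j.val + 1 = a + c i
    · rw [insert_idealOfHeights c i j h hj] at hid
      exact hadd hj (isHeights_of_isIdeal (bound _ (by omega)) hid)
    · have hdown := hid ⟨(i, j), h⟩ (Finset.mem_insert_self _ _)
        ⟨(i, ⟨j.val - 1, by omega⟩), by simp only; omega⟩
        (show i ≤ i ∧ _ from ⟨le_rfl, by rw [Fin.le_def]; simp⟩)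
      simp only [Finset.mem_insert, mem_idealOfHeights, Subtype.mk.injEq,
            Prod.mk.injEq, true_and, Fin.ext_iff] at hdown
      omega
  · intro hmem hid
    rw [mem_idealOfHeights] at hmem
    simp only at hmem
    by_cases hj : i.val + j.val + 2 = a + c i
    · rw [erase_idealOfHeights c i j h hj] at hid
      exact hrem hj (isHeights_of_isIdeal (bound _ (by have := hc.1 i; omega)) hid)
    · have := hc.1 i
      have hup := hid ⟨(i, ⟨j.val + 1, by omega⟩), by simp only; omega⟩
        (by
          simp only [Finset.mem_erase, mem_idealOfHeights, ne_eq, Subtype.mk.injEq,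
            Prod.mk.injEq, true_and, Fin.ext_iff]
          omega)
        ⟨(i, j), h⟩
        (show i ≤ i ∧ _ from ⟨le_rfl, by rw [Fin.le_def]; simp⟩)
      simp at hup

/-- The number of elements of column `i` that cannot be removed, because they lie below
elements of column `i + 1`. -/
def blockedHeight {a : ℕ} (c : Fin a → ℕ) (i : Fin a) : ℕ :=
  if h : i.val + 1 < a then c ⟨i.val + 1, h⟩ - 1 else 0

lemma IsHeights.update_iff {a : ℕ} {c : Fin a → ℕ} (hc : IsHeights c) (i : Fin a) (v : ℕ) :
    IsHeights (Function.update c i v) ↔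
      v ≤ i.val + 1 ∧ blockedHeight c i ≤ v ∧
        ∀ i' : Fin a, i.val = i'.val + 1 → v ≤ c i' + 1 := by
  constructor
  · rintro ⟨h1, h2⟩
    refine ⟨by simpa using h1 i, ?_, fun i' hi' => ?_⟩
    · rw [blockedHeight]
      split_ifs with h
      · have := h2 i ⟨i.val + 1, h⟩ rfl
        rw [Function.update_self, Function.update_of_ne (by simp [Fin.ext_iff])] at this
        omega
      · omega
    · have := h2 i' i hi'
      rwa [Function.update_self, Function.update_of_ne
        (by rw [ne_eq, Fin.ext_iff]; omega)] at this
  · rintro ⟨h1, h2, h3⟩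
    refine ⟨fun t => ?_, fun t t' ht => ?_⟩
    · by_cases ht : t = i
      · subst ht
        simpa using h1
      · simpa [ht] using hc.1 t
    · by_cases hti : t = i
      · subst hti
        rw [Function.update_self, Function.update_of_ne
          (by rw [ne_eq, Fin.ext_iff]; omega)]
        rw [blockedHeight, dif_pos (by omega)] at h2
        have ht' : t' = ⟨t.val + 1, by omega⟩ := Fin.ext ht
        rw [ht']
        omega
      · by_cases hti' : t' = i
        · subst hti'
          rw [Function.update_self, Function.update_of_ne hti]
          exact h3 t ht
        · rw [Function.update_of_ne hti, Function.update_of_ne hti']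
          exact hc.2 t t' ht

lemma foldr_ofFn_induction {α β : Type*} (f : β → α → α) (s : α) :
    ∀ (n : ℕ) (g : Fin n → β) (P : ℕ → α → Prop), P n s →
      (∀ (j : Fin n) (t : α), P (j.val + 1) t → P j.val (f (g j) t)) →
      P 0 (List.foldr f s (List.ofFn g)) := by
  intro n
  induction n with
  | zero =>
    intro g P h0 _
    simpa using h0
  | succ n ih =>
    intro g P h0 hstep
    rw [List.ofFn_succ, List.foldr_cons]
    exact hstep 0 _ (ih (fun j => g j.succ) (fun k => P (k + 1)) h0
      fun j t ht => hstep j.succ t ht)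

lemma colToggleU_of_addable {a : ℕ} {c : Fin a → ℕ} (i : Fin a)
    (hc : IsHeights c) (hadd : IsHeights (Function.update c i (c i + 1))) :
    colToggleU i (idealOfHeights c) = idealOfHeights (Function.update c i (c i + 1)) := by
  have hi := ((hc.update_iff i _).1 hadd).1
  have key := foldr_ofFn_induction
    (fun (j : Fin a) K =>
      if h : a ≤ i.val + j.val + 1 then toggle (⟨(i, j), h⟩ : Ua a) K else K)
    (idealOfHeights c) a (fun j => j)
    (fun k K => K = if a + c i < i.val + k + 1 then idealOfHeights c
      else idealOfHeights (Function.update c i (c i + 1)))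
    (by rw [if_pos (by omega)]) ?_
  · rw [if_neg (by omega)] at key
    exact key
  · rintro j K rfl
    by_cases h : a ≤ i.val + j.val + 1
    · rw [dif_pos h]
      rcases lt_trichotomy (a + c i) (i.val + j.val + 1) with hlt | heq | hgt
      · rw [if_pos (by omega), if_pos hlt,
          toggle_eq_self hc i j h (by omega) (by omega)]
      · rw [if_pos (by omega), if_neg (by omega),
          toggle_eq_of_addable i j h heq.symm hadd]
      · rw [if_neg (by omega), if_neg (by omega), toggle_eq_self hadd i j h]
        · rw [Function.update_self]
          omega
        · rw [Function.update_self]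
          omega
    · rw [dif_neg h, if_neg (by omega), if_neg (by omega)]

lemma colToggleU_of_not_addable {a : ℕ} {c : Fin a → ℕ} (i : Fin a)
    (hc : IsHeights c) (hadd : ¬ IsHeights (Function.update c i (c i + 1))) :
    colToggleU i (idealOfHeights c) =
      idealOfHeights (Function.update c i (blockedHeight c i)) := by
  have hself : IsHeights (Function.update c i (c i)) := by
    rwa [Function.update_eq_self]
  obtain ⟨hi, hb, hup⟩ := (hc.update_iff i _).1 hself
  have hbetween : ∀ v, blockedHeight c i ≤ v → v ≤ c i →
      IsHeights (Function.update c i v) := fun v h1 h2 =>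
    (hc.update_iff i v).2 ⟨by omega, h1, fun i' hi' => h2.trans (hup i' hi')⟩
  have key := foldr_ofFn_induction
    (fun (j : Fin a) K =>
      if h : a ≤ i.val + j.val + 1 then toggle (⟨(i, j), h⟩ : Ua a) K else K)
    (idealOfHeights c) a (fun j => j)
    (fun k K => K = idealOfHeights (Function.update c i
      (min (c i) (max (blockedHeight c i) (i.val + k + 1 - a)))))
    (by rw [min_eq_left (by omega), Function.update_eq_self]) ?_
  · rw [min_eq_right (by omega), max_eq_left (by omega)] at key
    exact key
  · rintro j K rfl
    by_cases h : a ≤ i.val + j.val + 1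
    · rw [dif_pos h]
      by_cases hmove : blockedHeight c i ≤ i.val + j.val + 1 - a ∧
          i.val + j.val + 1 - a < c i
      · obtain ⟨v, hv⟩ : ∃ v, min (c i) (max (blockedHeight c i)
            (i.val + (j.val + 1) + 1 - a)) = v := ⟨_, rfl⟩
        have hw : min (c i) (max (blockedHeight c i) (i.val + j.val + 1 - a)) = v - 1 := by
          omega
        have hrem := hbetween (v - 1) (by omega) (by omega)
        rw [hv, hw, toggle_eq_of_removable i j h]
        · rw [Function.update_self, Function.update_idem]
        · rw [Function.update_self]
          omega
        · rwa [Function.update_self, Function.update_idem]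
      · obtain ⟨v, hv⟩ : ∃ v, min (c i) (max (blockedHeight c i)
            (i.val + (j.val + 1) + 1 - a)) = v := ⟨_, rfl⟩
        have hw : min (c i) (max (blockedHeight c i) (i.val + j.val + 1 - a)) = v := by
          omega
        rw [hv, hw, toggle_eq_self (hbetween v (by omega) (by omega))]
        · rw [Function.update_self, Function.update_idem]
          intro hj
          obtain rfl : v = c i := by omega
          exact hadd
        · rw [Function.update_self, Function.update_idem, hc.update_iff]
          omega
    · rw [dif_neg h]
      congr 3
      omega

lemma extS_succ {k m : ℕ} (x : Fin k → ℕ) (n : ℕ) (h : n < k) :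
    extS k m x (n + 1) = x ⟨n, h⟩ := by
  rw [extS, dif_pos (by omega)]
  rfl

lemma extS_of_lt {k m : ℕ} (x : Fin k → ℕ) (n : ℕ) (h : k < n) :
    extS k m x n = m + 1 := by
  rw [extS, dif_neg (by omega), if_neg (by omega)]

lemma extS_zero {k m : ℕ} (x : Fin k → ℕ) : extS k m x 0 = 0 := by
  rw [extS, dif_neg (by omega), if_pos rfl]

lemma winch_index_lt_iff {a : ℕ} {c : Fin a → ℕ} (hc : IsHeights c) (i : Fin a) :
    c i + 2 * i.rev.val + 1 + 1 <
        extS a (2 * a) (betaMap a (idealOfHeights c)) (i.rev.val + 2) ↔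
      IsHeights (Function.update c i (c i + 1)) := by
  have hself : IsHeights (Function.update c i (c i)) := by
    rwa [Function.update_eq_self]
  obtain ⟨-, hb, -⟩ := (hc.update_iff i _).1 hself
  rw [hc.update_iff]
  have hrev : i.rev.val = a - (i.val + 1) := Fin.val_rev i
  by_cases h0 : i.val = 0
  · rw [extS_of_lt _ _ (by omega)]
    constructor
    · exact fun h => ⟨by omega, by omega, fun i' hi' => by omega⟩
    · rintro ⟨h1, -, -⟩
      omega
  · rw [extS_succ _ (i.rev.val + 1) (by omega), betaMap_idealOfHeights hc]
    have hr : (⟨i.rev.val + 1, by omega⟩ : Fin a).rev = ⟨i.val - 1, by omega⟩ := by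
      apply Fin.ext
      rw [Fin.val_rev]
      simp only
      omega
    rw [hr]
    have hb' := hc.1 ⟨i.val - 1, by omega⟩
    simp only at *
    constructor
    · refine fun h => ⟨by omega, by omega, fun i' hi' => ?_⟩
      have hi'' : i' = ⟨i.val - 1, by omega⟩ := Fin.ext (by simp only; omega)
      rw [hi'']
      omega
    · rintro ⟨-, -, h⟩
      have := h ⟨i.val - 1, by omega⟩ (by simp only; omega)
      omega

lemma max_extS_eq {a : ℕ} {c : Fin a → ℕ} (hc : IsHeights c) (i : Fin a) :
    max (extS a (2 * a) (betaMap a (idealOfHeights c)) i.rev.val + 1) (2 * i.rev.val + 1) =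
      blockedHeight c i + 2 * i.rev.val + 1 := by
  have hrev : i.rev.val = a - (i.val + 1) := Fin.val_rev i
  rw [blockedHeight]
  split_ifs with h
  · obtain ⟨n, hn⟩ : ∃ n, i.rev.val = n + 1 := ⟨i.rev.val - 1, by omega⟩
    rw [hn, extS_succ _ n (by omega), betaMap_idealOfHeights hc]
    have hr : (⟨n, by omega⟩ : Fin a).rev = ⟨i.val + 1, h⟩ := by
      apply Fin.ext
      rw [Fin.val_rev]
      simp only
      omega
    rw [hr]
    simp only
    omega
  · have hn : i.rev.val = 0 := by omega
    rw [hn, extS_zero]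
    simp

lemma betaMap_colToggleU {a : ℕ} {c : Fin a → ℕ} (hc : IsHeights c) (i : Fin a) :
    betaMap a (colToggleU i (idealOfHeights c)) =
      winchL a (2 * a) (fun t : Fin a => 2 * t.val + 1) i.rev
        (betaMap a (idealOfHeights c)) := by
  have hself : IsHeights (Function.update c i (c i)) := by
    rwa [Function.update_eq_self]
  obtain ⟨hi, hb, hup⟩ := (hc.update_iff i _).1 hself
  have main : ∀ v, IsHeights (Function.update c i v) →
      max (winch a (2 * a) i.rev (betaMap a (idealOfHeights c)) i.rev) (2 * i.rev.val + 1) =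
        v + 2 * i.rev.val + 1 →
      betaMap a (idealOfHeights (Function.update c i v)) =
        winchL a (2 * a) (fun t : Fin a => 2 * t.val + 1) i.rev
          (betaMap a (idealOfHeights c)) := by
    intro v hv hmax
    ext j
    rw [betaMap_idealOfHeights hv, winchL]
    split_ifs with hj
    · subst hj
      rw [hmax, Fin.rev_rev, Function.update_self]
    · rw [betaMap_idealOfHeights hc, Function.update_of_ne]
      rintro rfl
      exact hj (Fin.rev_rev j).symm
  have hlt := winch_index_lt_iff hc i
  by_cases hadd : IsHeights (Function.update c i (c i + 1))
  · rw [colToggleU_of_addable i hc hadd]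
    refine main _ hadd ?_
    rw [winch, if_pos rfl, betaMap_idealOfHeights hc, Fin.rev_rev, if_pos (hlt.2 hadd)]
    omega
  · rw [colToggleU_of_not_addable i hc hadd]
    refine main _ ((hc.update_iff i _).2
      ⟨hb.trans hi, le_rfl, fun i' hi' => hb.trans (hup i' hi')⟩) ?_
    rw [winch, if_pos rfl, betaMap_idealOfHeights hc, Fin.rev_rev,
      if_neg fun h => hadd (hlt.1 h), max_extS_eq hc]

lemma smem_betaMap {a : ℕ} {c : Fin a → ℕ} (hc : IsHeights c) :
    Smem a (2 * a) (betaMap a (idealOfHeights c)) := by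
  refine ⟨fun j k hjk => ?_, fun j => ?_⟩
  · rw [betaMap_idealOfHeights hc, betaMap_idealOfHeights hc]
    have hlt : j.val < k.val := hjk
    have := hc.apply_le_add_of_val_eq_add k.rev (k.val - j.val) j.rev
      (by rw [Fin.val_rev, Fin.val_rev]; omega)
    omega
  · rw [betaMap_idealOfHeights hc]
    have := hc.1 j.rev
    rw [Fin.val_rev] at this
    omega

lemma StrictMono.add_le_apply_of_val_eq_add {k : ℕ} {y : Fin k → ℕ} (hy : StrictMono y)
    (j : Fin k) :
    ∀ (n : ℕ) (j' : Fin k), j'.val = j.val + n → y j + n ≤ y j' := by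
  intro n
  induction n with
  | zero =>
    intro j' h
    obtain rfl : j' = j := Fin.ext h
    omega
  | succ n ih =>
    intro j' h
    have h1 := ih ⟨j.val + n, by omega⟩ rfl
    have h2 : y ⟨j.val + n, by omega⟩ < y j' := hy (by rw [Fin.lt_def]; simp only; omega)
    omega

lemma exists_betaMap_eq {a : ℕ} {y : Fin a → ℕ} (hy : Smem a (2 * a) y)
    (hl : ∀ j : Fin a, 2 * j.val + 1 ≤ y j) :
    ∃ c : Fin a → ℕ, IsHeights c ∧ betaMap a (idealOfHeights c) = y := by
  have hc : IsHeights fun i : Fin a => y i.rev - (2 * i.rev.val + 1) := by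
    refine ⟨fun i => ?_, fun i i' hi => ?_⟩
    · have h0 := i.isLt
      have h1 := hy.1.add_le_apply_of_val_eq_add i.rev i.val ⟨a - 1, by omega⟩
        (by rw [Fin.val_rev]; simp only; omega)
      have h2 := (hy.2 ⟨a - 1, by omega⟩).2
      have h3 := hl i.rev
      have h4 := Fin.val_rev i
      simp only
      omega
    · have h1 : y i'.rev < y i.rev := hy.1 (by rw [Fin.rev_lt_rev, Fin.lt_def]; omega)
      have h2 := hl i.rev
      have h3 := hl i'.rev
      have h4 := Fin.val_rev i
      have h5 := Fin.val_rev i'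
      simp only
      omega
  refine ⟨_, hc, ?_⟩
  ext j
  rw [betaMap_idealOfHeights hc, Fin.rev_rev]
  have := hl j
  omega

/-- with lower bounds `l_j = 2j − 1`, the map `β` is a bijection from the
order ideals of `U_a` onto `S'_{a,2a} = {x ∈ S_{a,2a} : x_j ≥ l_j}` and it intertwines
the column toggle `σ_{C_j}` with winching with lower bounds `W̲_{a+1−j}` (in 0-based
indexing, column `j` corresponds to index `j.rev`, and `l` is `fun j => 2*j+1`). -/
theorem stmt_3 (a : ℕ) (ha : 1 ≤ a) :
    Set.BijOn (betaMap a) {I : Finset (Ua a) | IsIdeal I}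
      {y : Fin a → ℕ | Smem a (2 * a) y ∧ ∀ j : Fin a, 2 * j.val + 1 ≤ y j} ∧
    ∀ I : Finset (Ua a), IsIdeal I → ∀ j : Fin a,
      betaMap a (colToggleU j I) =
        winchL a (2 * a) (fun t : Fin a => 2 * t.val + 1) j.rev (betaMap a I) := by
  refine ⟨⟨?_, ?_, ?_⟩, ?_⟩
  · intro I hI
    obtain ⟨c, hc, rfl⟩ := exists_heights hI
    refine ⟨smem_betaMap hc, fun j => ?_⟩
    rw [betaMap_idealOfHeights hc]
    omega
  · intro I hI I' hI' heq
    obtain ⟨c, hc, rfl⟩ := exists_heights hI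
    obtain ⟨d, hd, rfl⟩ := exists_heights hI'
    congr 1
    ext i
    have := congrFun heq i.rev
    rw [betaMap_idealOfHeights hc, betaMap_idealOfHeights hd, Fin.rev_rev] at this
    omega
  · rintro y ⟨hy, hl⟩
    obtain ⟨c, hc, rfl⟩ := exists_betaMap_eq hy hl
    exact ⟨_, hc.isIdeal, rfl⟩
  · intro I hI j
    obtain ⟨c, hc, rfl⟩ := exists_heights hI
    exact betaMap_colToggleU hc j
end

section
/- Let 1 ≤ k ≤ m and let ν be any permutation of {1,…,k}. The multiset of orbit sizes of the permutation W_ν acting on S_{k,m} equals the multiset of orbit sizes of the rotation R acting on N_{k,m}. In particular, the multiset of orbit sizes of W_ν on S_{k,m} is the same for every choice of the permutation ν. -/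
-- Rotation on necklaces `N_{k,m}` (represented, like `S_{k,m}`, as strictly increasing
-- tuples with entries in `{1, …, m}`): add 1 to every entry if the last entry is `< m`
-- (equivalently, on the domain, if all entries are `< m`); otherwise rotate:
-- `R(x) = (1, x_1 + 1, …, x_{k−1} + 1)`.
open Classical in
noncomputable def rotN (k m : ℕ) (x : Fin k → ℕ) : Fin k → ℕ := fun i =>
  if ∀ t, x t < m then x i + 1
  else if i.val = 0 then 1
  else x ⟨i.val - 1, lt_of_le_of_lt (Nat.sub_le _ _) i.isLt⟩ + 1

/-- If the generators `g i`, `g j` commute whenever `|i - j| ≥ 2`, then the products of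
`g 0, …, g (n - 1)` in any two orders are conjugate. -/
theorem isConj_prod_of_perm_range {G : Type*} [Group G] (n : ℕ) (g : ℕ → G)
    (hg : ∀ i j, i + 2 ≤ j → j < n → Commute (g i) (g j)) (l : List ℕ)
    (hl : l.Perm (List.range n)) :
    IsConj (l.map g).prod ((List.range n).map g).prod := by
  induction n generalizing g l with
  | zero =>
    obtain rfl : l = [] := by simpa using hl
    exact IsConj.refl _
  | succ n ih =>
    rcases n with _ | n
    · obtain rfl : l = [0] := by simpa using hl
      exact IsConj.refl _
    obtain ⟨A, B, rfl⟩ := List.append_of_mem (hl.mem_iff.2 (by simp : n + 1 ∈ List.range (n + 1 + 1)))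
    have hAB : (A ++ B).Perm (List.range (n + 1)) := by
      rw [List.range_succ] at hl
      exact (List.perm_cons (n + 1)).1
        ((List.perm_middle.symm.trans hl).trans (List.perm_append_singleton _ _))
    have hlt : ∀ i ∈ A ++ B, i < n + 1 := fun i hi => List.mem_range.1 (hAB.mem_iff.1 hi)
    have hnd : (A ++ B).Nodup := hAB.nodup_iff.2 List.nodup_range
    have comm : ∀ L : List ℕ, (∀ i ∈ L, i < n + 1) → n ∉ L →
        Commute (L.map g).prod (g (n + 1)) := by
      intro L hL hn
      apply Commute.list_prod_left
      intro y hy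
      obtain ⟨i, hi, rfl⟩ := List.mem_map.1 hy
      have h1 := hL i hi
      have h2 : i ≠ n := fun h => hn (h ▸ hi)
      exact hg i (n + 1) (by omega) (by omega)
    have step : IsConj ((A ++ (n + 1) :: B).map g).prod (((A ++ B).map g).prod * g (n + 1)) := by
      simp only [List.map_append, List.map_cons, List.prod_append, List.prod_cons]
      by_cases hnA : n ∈ A
      · have hnB : n ∉ B := fun h => (List.nodup_append.1 hnd).2.2 n hnA n h rfl
        have := comm B (fun i hi => hlt i (by simp [hi])) hnB
        rw [← this.eq, mul_assoc]
      · have := comm A (fun i hi => hlt i (by simp [hi])) hnA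
        rw [← mul_assoc, this.eq, isConj_iff]
        exact ⟨(g (n + 1))⁻¹, by group⟩
    have hnmem : n ∈ A ++ B := hAB.mem_iff.2 (by simp)
    obtain ⟨C, D, hCD⟩ := List.append_of_mem hnmem
    rw [hCD] at step hAB hlt hnd
    have hnC : n ∉ C := fun h => (List.nodup_append.1 hnd).2.2 n h n (by simp) rfl
    have hnD : n ∉ D := (List.nodup_cons.1 (List.nodup_append.1 hnd).2.1).1
    let g' := Function.update g n (g n * g (n + 1))
    have map_eq : ∀ L : List ℕ, n ∉ L → L.map g' = L.map g := fun L hL =>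
      List.map_congr_left fun i hi => Function.update_of_ne (fun h : i = n => hL (h ▸ hi)) _ _
    have merge : ((C ++ n :: D).map g).prod * g (n + 1) = ((C ++ n :: D).map g').prod := by
      have := comm D (fun i hi => hlt i (by simp [hi])) hnD
      simp only [List.map_append, List.map_cons, List.prod_append, List.prod_cons,
        map_eq C hnC, map_eq D hnD, g', Function.update_self, mul_assoc, this.eq]
    have hrange : ((List.range (n + 1 + 1)).map g).prod = ((List.range (n + 1)).map g').prod := by
      simp only [List.range_succ, List.map_append, List.prod_append, List.map_cons, List.map_nil,
        List.prod_singleton, map_eq (List.range n) (by simp), g', Function.update_self, mul_assoc]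
    rw [hrange]
    refine step.trans (merge ▸ ih g' (fun i j hij hj => ?_) _ hAB)
    have hi : g' i = g i := Function.update_of_ne (by omega) _ _
    rw [hi]
    by_cases hjn : j = n
    · subst hjn
      simp only [g', Function.update_self]
      exact (hg i j hij (by omega)).mul_right (hg i (j + 1) (by omega) (by omega))
    · have hj' : g' j = g j := Function.update_of_ne hjn _ _
      rw [hj']
      exact hg i j hij (by omega)

section Winch

variable {k m : ℕ}

theorem extS_lt_apply {x : Fin k → ℕ} (hx : Smem k m x) (i : Fin k) : extS k m x i < x i := by
  unfold extS
  split_ifs with h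
  · exact hx.1 (Fin.mk_lt_of_lt_val (by omega))
  · exact (hx.2 i).1
  · exact absurd i.isLt (by omega)

theorem apply_lt_extS {x : Fin k → ℕ} (hx : Smem k m x) (i : Fin k) :
    x i < extS k m x (i + 2) := by
  unfold extS
  split_ifs with h
  · exact hx.1 (Fin.lt_def.2 (by simp))
  · contradiction
  · exact Nat.lt_succ_of_le (hx.2 i).2

theorem apply_le_extS {x : Fin k → ℕ} (hx : Smem k m x) {a i : Fin k} (h : a < i) :
    x a ≤ extS k m x i := by
  have := Fin.lt_def.1 h
  rw [extS, dif_pos (by omega)]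
  exact hx.1.monotone (Fin.le_def.2 (by simp; omega))

theorem extS_le_apply {x : Fin k → ℕ} (hx : Smem k m x) {i b : Fin k} (h : i < b) :
    extS k m x (i + 2) ≤ x b := by
  have := Fin.lt_def.1 h
  rw [extS, dif_pos (by omega)]
  exact hx.1.monotone (Fin.le_def.2 (by simp; omega))

theorem extS_le {x : Fin k → ℕ} (hx : Smem k m x) (j : ℕ) : extS k m x j ≤ m + 1 := by
  unfold extS
  split_ifs
  · exact (hx.2 _).2.trans (Nat.le_succ m)
  · omega
  · exact le_rfl

theorem winch_self (i : Fin k) (x : Fin k → ℕ) : winch k m i x i =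
    if x i + 1 < extS k m x (i + 2) then x i + 1 else extS k m x i + 1 := by
  simp [winch]

theorem winch_of_ne {i t : Fin k} (h : t ≠ i) (x : Fin k → ℕ) : winch k m i x t = x t := by
  simp [winch, h]

theorem extS_congr {x y : Fin k → ℕ} {j : ℕ} (h : ∀ t : Fin k, t.val + 1 = j → x t = y t) :
    extS k m x j = extS k m y j := by
  unfold extS
  split_ifs
  · exact h _ (by simp; omega)
  · rfl
  · rfl

theorem extS_winch {i : Fin k} {x : Fin k → ℕ} {j : ℕ} (h : j ≠ i + 1) :
    extS k m (winch k m i x) j = extS k m x j :=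
  extS_congr fun t ht => winch_of_ne (by rintro rfl; omega) x

theorem smem_winch {x : Fin k → ℕ} (hx : Smem k m x) (i : Fin k) :
    Smem k m (winch k m i x) := by
  have hlo := extS_lt_apply hx i
  have hhi := extS_le hx (i + 2)
  have hi := hx.2 i
  refine ⟨fun a b hab => ?_, fun a => ?_⟩
  · have hxab := hx.1 hab
    by_cases ha : a = i
    · subst ha
      rw [winch_self, winch_of_ne hab.ne']
      have := extS_le_apply hx hab
      split_ifs <;> omega
    by_cases hb : b = i
    · subst hb
      rw [winch_self, winch_of_ne hab.ne]
      have := apply_le_extS hx hab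
      split_ifs <;> omega
    rwa [winch_of_ne ha, winch_of_ne hb]
  · by_cases ha : a = i
    · subst ha
      rw [winch_self]
      split_ifs <;> omega
    · rw [winch_of_ne ha]
      exact hx.2 a

theorem winch_injOn (i : Fin k) : Set.InjOn (winch k m i) {x | Smem k m x} := by
  intro x hx y hy h
  have hne : ∀ t, t ≠ i → x t = y t := fun t ht => by
    have := congrFun h t
    rwa [winch_of_ne ht, winch_of_ne ht] at this
  have h0 : extS k m x i = extS k m y i :=
    extS_congr fun t ht => hne t (by rintro rfl; omega)
  have h2 : extS k m x (i + 2) = extS k m y (i + 2) :=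
    extS_congr fun t ht => hne t (by rintro rfl; omega)
  have hi := congrFun h i
  rw [winch_self, winch_self, h0, h2] at hi
  have := extS_lt_apply hx i
  have := extS_lt_apply hy i
  have := apply_lt_extS hx i
  have := apply_lt_extS hy i
  funext t
  by_cases ht : t = i
  · subst ht
    split_ifs at hi <;> omega
  · exact hne t ht

theorem winch_comm {i j : Fin k} (h : i.val + 2 ≤ j) (x : Fin k → ℕ) :
    winch k m i (winch k m j x) = winch k m j (winch k m i x) := by
  have hij : i ≠ j := by rintro rfl; omega
  funext t
  by_cases hi : t = i
  · subst hi
    rw [winch_of_ne hij, winch_self, winch_self, winch_of_ne hij,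
      extS_winch (by omega), extS_winch (by omega)]
  by_cases hj : t = j
  · subst hj
    rw [winch_of_ne hij.symm, winch_self, winch_self, winch_of_ne hij.symm,
      extS_winch (by omega), extS_winch (by omega)]
  · simp only [winch_of_ne hi, winch_of_ne hj]

instance finite_Smem : Finite {x // Smem k m x} :=
  Set.Finite.subset (Set.finite_Icc (fun _ : Fin k => 1) (fun _ => m))
    fun _ hx => ⟨fun i => (hx.2 i).1, fun i => (hx.2 i).2⟩

variable (k m) in
/-- Winching at `i` as a permutation of `S_{k,m}`; the identity if `k ≤ i`. -/
noncomputable def winchEquiv (i : ℕ) : Equiv.Perm {x // Smem k m x} :=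
  if h : i < k then
    Equiv.ofBijective (fun x => ⟨winch k m ⟨i, h⟩ x.1, smem_winch x.2 _⟩)
      (Finite.injective_iff_bijective.1 fun x y hxy =>
        Subtype.ext (winch_injOn _ x.2 y.2 (congrArg Subtype.val hxy)))
  else 1

theorem coe_winchEquiv (i : Fin k) (x : {x // Smem k m x}) :
    (winchEquiv k m i x).1 = winch k m i x.1 := by
  simp [winchEquiv]

theorem commute_winchEquiv {i j : ℕ} (hij : i + 2 ≤ j) (hj : j < k) :
    Commute (winchEquiv k m i) (winchEquiv k m j) := by
  ext1 x
  apply Subtype.ext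
  have hi : i < k := by omega
  simp only [Equiv.Perm.mul_apply]
  simp only [coe_winchEquiv ⟨i, hi⟩, coe_winchEquiv ⟨j, hj⟩]
  exact winch_comm hij _

theorem coe_prod_winchEquiv (l : List (Fin k)) (x : {x // Smem k m x}) :
    (((l.map Fin.val).reverse.map (winchEquiv k m)).prod x).1 =
      l.foldl (fun y t => winch k m t y) x.1 := by
  induction l generalizing x with
  | nil => rfl
  | cons a l ih =>
    simp only [List.map_cons, List.reverse_cons, List.map_append, List.prod_append, List.map_nil,
      List.prod_singleton, Equiv.Perm.mul_apply, List.foldl_cons, ih, coe_winchEquiv]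

theorem exists_perm_eq_winchPerm (ν : Equiv.Perm (Fin k)) :
    ∃ a : Equiv.Perm {x // Smem k m x}, (∀ x, (a x).1 = winchPerm k m ν x.1) ∧
      IsConj a ((List.range k).map (winchEquiv k m)).prod := by
  refine ⟨(((List.ofFn ν).map Fin.val).reverse.map (winchEquiv k m)).prod, fun x => ?_,
    isConj_prod_of_perm_range k _ (fun i j => commute_winchEquiv) _ ?_⟩
  · have : List.ofFn ν = (List.ofFn fun t : Fin k => t).map ν := by
      rw [List.map_ofFn]; rfl
    rw [coe_prod_winchEquiv, winchPerm, this, List.foldl_map]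
  · refine (List.reverse_perm _).trans ((List.perm_ext_iff_of_nodup ?_ List.nodup_range).2 ?_)
    · exact (List.nodup_ofFn.2 ν.injective).map Fin.val_injective
    · intro i
      simp only [List.mem_map, List.mem_ofFn, List.mem_range]
      constructor
      · rintro ⟨t, -, rfl⟩
        exact t.2
      · intro hi
        exact ⟨⟨i, hi⟩, ⟨ν.symm ⟨i, hi⟩, by simp⟩, rfl⟩

/-- Winching at `n` turns a tuple already rotated at the indices above `n` into one rotated at
the indices from `n` on. -/
theorem winch_partial_rotN {x : Fin k → ℕ} (hx : Smem k m x) (n : Fin k) :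
    winch k m n (fun i => if n.val + 1 ≤ i then rotN k m x i else x i) =
      fun i : Fin k => if n.val ≤ i then rotN k m x i else x i := by
  funext t
  by_cases ht : t = n
  · subst ht
    have h0 : extS k m (fun i : Fin k => if t.val + 1 ≤ i then rotN k m x i else x i) t =
        extS k m x t := extS_congr fun s hs => if_neg (by omega)
    have h2 : extS k m (fun i : Fin k => if t.val + 1 ≤ i then rotN k m x i else x i) (t + 2) =
        extS k m (rotN k m x) (t + 2) := extS_congr fun s hs => if_pos (by omega)
    simp only [winch_self, h0, h2, le_refl, if_true,
      if_neg (show ¬t.val + 1 ≤ t by omega)]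
    have hlt := apply_lt_extS hx t
    by_cases hall : ∀ s, x s < m
    · have hr : rotN k m x = fun i => x i + 1 := funext fun i => if_pos hall
      rw [hr, if_pos]
      unfold extS at hlt ⊢
      have := hall t
      split_ifs at hlt ⊢ <;> first | omega | exact Nat.succ_lt_succ hlt
    · have hr : extS k m (rotN k m x) (t + 2) ≤ x t + 1 := by
        unfold extS
        split_ifs with h
        · simp [rotN, hall]
        · omega
        · push Not at hall
          obtain ⟨s, hs⟩ := hall
          have : x s ≤ x t := hx.1.monotone (Fin.le_def.2 (by omega))
          omega
      rw [if_neg (by omega)]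
      by_cases h : t.val = 0
      · simp [rotN, hall, extS, h]
      · rw [extS, dif_pos (by omega)]
        simp [rotN, hall, h]
  · rw [winch_of_ne ht]
    have : t.val ≠ n := fun h => ht (Fin.ext h)
    split_ifs <;> first | rfl | omega

theorem coe_prod_range_winchEquiv (x : {x // Smem k m x}) :
    (((List.range k).map (winchEquiv k m)).prod x).1 = rotN k m x.1 := by
  have key : ∀ n ≤ k, ∀ y : {x // Smem k m x},
      y.1 = (fun i : Fin k => if n ≤ i then rotN k m x.1 i else x.1 i) →
      (((List.range n).map (winchEquiv k m)).prod y).1 = rotN k m x.1 := by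
    intro n
    induction n with
    | zero =>
      intro _ y hy
      simpa using hy
    | succ n ih =>
      intro hn y hy
      rw [List.range_succ, List.map_append, List.prod_append, Equiv.Perm.mul_apply]
      refine ih (by omega) _ ?_
      simp only [List.map_cons, List.map_nil, List.prod_singleton]
      rw [coe_winchEquiv ⟨n, hn⟩, hy]
      exact winch_partial_rotN x.2 ⟨n, hn⟩
  exact key k le_rfl x (funext fun i => (if_neg (by omega)).symm)

end Winch

/-- Conjugate permutations of a subtype give conjugate maps of the ambient type. -/
theorem exists_bijOn_of_isConj {α : Type*} {p : α → Prop} {a b : Equiv.Perm {x // p x}}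
    (h : IsConj a b) {F H : α → α} (ha : ∀ x, (a x).1 = F x.1) (hb : ∀ x, (b x).1 = H x.1) :
    ∃ φ : α → α, Set.BijOn φ {x | p x} {x | p x} ∧ ∀ x, p x → φ (F x) = H (φ x) := by
  classical
  obtain ⟨c, hc⟩ := isConj_iff.1 h
  have hφ : ∀ x : {x // p x}, Equiv.Perm.ofSubtype c x.1 = (c x).1 :=
    Equiv.Perm.ofSubtype_apply_coe c
  refine ⟨Equiv.Perm.ofSubtype c, ⟨fun x hx => ?_, (Equiv.injective _).injOn, fun y hy => ?_⟩,
    fun x hx => ?_⟩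
  · rw [hφ ⟨x, hx⟩]
    exact (c ⟨x, hx⟩).2
  · exact ⟨(c.symm ⟨y, hy⟩).1, (c.symm ⟨y, hy⟩).2, by rw [hφ]; simp⟩
  · rw [← ha ⟨x, hx⟩, hφ, hφ ⟨x, hx⟩, ← hb, ← hc]
    simp

/-- the permutation `W_ν` of `S_{k,m}` has the same multiset of orbit sizes
as the rotation `R` of `N_{k,m}`; this is expressed by the existence of a bijection of
`S_{k,m}` onto `N_{k,m}` conjugating `W_ν` into `R`.  In particular, for any two
permutations `ν, ω` there is a bijection of `S_{k,m}` conjugating `W_ν` into `W_ω`,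
so the orbit structure of `W_ν` is independent of `ν`. -/
theorem stmt_6 (k m : ℕ) (hk : 1 ≤ k) (hkm : k ≤ m) (ν : Equiv.Perm (Fin k)) :
    (∃ φ : (Fin k → ℕ) → (Fin k → ℕ),
      Set.BijOn φ {x | Smem k m x} {x | Smem k m x} ∧
      ∀ x, Smem k m x → φ (winchPerm k m ν x) = rotN k m (φ x)) ∧
    (∀ ω : Equiv.Perm (Fin k), ∃ ψ : (Fin k → ℕ) → (Fin k → ℕ),
      Set.BijOn ψ {x | Smem k m x} {x | Smem k m x} ∧
      ∀ x, Smem k m x → ψ (winchPerm k m ν x) = winchPerm k m ω (ψ x)) := by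
  obtain ⟨a, ha, hconj⟩ := exists_perm_eq_winchPerm (m := m) ν
  refine ⟨exists_bijOn_of_isConj hconj ha coe_prod_range_winchEquiv, fun ω => ?_⟩
  obtain ⟨b, hb, hconj'⟩ := exists_perm_eq_winchPerm (m := m) ω
  exact exists_bijOn_of_isConj (hconj.trans hconj'.symm) ha hb
end

section
/- Let n ≥ 1 and let ν be any permutation of {1,…,n}. Then the 2n-th iterate of WZ_ν is the identity on S_n: for every x ∈ S_n, WZ_ν^{2n}(x) = x. -/
-- The set `S_n`: tuples `(x_1, …, x_n)` which consist of a (possibly empty) prefix of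
-- zeros followed by a strictly increasing sequence of values in `{1, …, n}`.
def SZmem (n : ℕ) (x : Fin n → ℕ) : Prop :=
  (∀ i, x i ≤ n) ∧ ∀ i j : Fin n, i < j → (x i = 0 ∨ x i < x j)

-- `extZ n x j` is the `j`-th entry of `x` in 0-based indexing, with the convention
-- that entries past the end equal `n + 1`.
def extZ (n : ℕ) (x : Fin n → ℕ) (j : ℕ) : ℕ :=
  if h : j < n then x ⟨j, h⟩ else n + 1

-- Winching with zeros at (0-based) index `i`:
-- `y_i = x_i + 1` if `x_i + 1 < min(x_{i+1}, n+1)`; otherwise `y_i = x_{i−1} + 1`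
-- if `i > 1` and `x_{i−1} > 0`; otherwise `y_i = 0`.
def winchZ (n : ℕ) (i : Fin n) (x : Fin n → ℕ) : Fin n → ℕ := fun j =>
  if j = i then
    (if x i + 1 < min (extZ n x (i.val + 1)) (n + 1) then x i + 1
     else if 0 < i.val ∧ 0 < x ⟨i.val - 1, lt_of_le_of_lt (Nat.sub_le _ _) i.isLt⟩ then
       x ⟨i.val - 1, lt_of_le_of_lt (Nat.sub_le _ _) i.isLt⟩ + 1
     else 0)
  else x j

-- `WZ_ν = WZ_{ν(n)} ∘ … ∘ WZ_{ν(1)}` (so `WZ_{ν(1)}` is applied first).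
def winchZPerm (n : ℕ) (ν : Equiv.Perm (Fin n)) (x : Fin n → ℕ) : Fin n → ℕ :=
  List.foldl (fun y t => winchZ n (ν t) y) x (List.ofFn (fun t : Fin n => t))

/-- The value which winching puts between the left neighbour `a` and the right neighbour `c`
of an entry `b`. -/
def winchValue (a b c : ℕ) : ℕ := if b + 1 < c then b + 1 else if 0 < a then a + 1 else 0

/-- A tuple of `S_n`, written as a sequence with the boundary entries `u 0 = 0` and
`u (n + 1) = n + 1` added. -/
structure IsPaddedTuple (n : ℕ) (u : ℕ → ℕ) : Prop where
  zero : u 0 = 0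
  last : u (n + 1) = n + 1
  step : ∀ j ≤ n, u j = 0 ∨ u j < u (j + 1)

namespace IsPaddedTuple

variable {n : ℕ} {u v : ℕ → ℕ}

lemma lt_of_lt (hu : IsPaddedTuple n u) {i j : ℕ} (hij : i < j) (hj : j ≤ n + 1) :
    u i = 0 ∨ u i < u j := by
  induction j, hij using Nat.le_induction with
  | base => exact hu.step i (by omega)
  | succ j hij ih =>
    have := ih (by omega)
    have := hu.step j (by omega)
    omega

lemma le_self (hu : IsPaddedTuple n u) {j : ℕ} (hj : j ≤ n) : u j ≤ n := by
  have := hu.lt_of_lt (show j < n + 1 by omega) le_rfl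
  have := hu.last
  omega

lemma self_le (hu : IsPaddedTuple n u) (h : u 1 ≠ 0) {j : ℕ} (hj : 1 ≤ j) (hjn : j ≤ n) :
    j ≤ u j := by
  induction j, hj using Nat.le_induction with
  | base => omega
  | succ j hj ih =>
    have := ih (by omega)
    have := hu.step j (by omega)
    omega

lemma not_lt_of_range (hu : IsPaddedTuple n u) (hv : IsPaddedTuple n v)
    (h : ∀ a, 1 ≤ a → a ≤ n → (∃ i ≤ n, v i = a) → ∃ i ≤ n, u i = a)
    {j : ℕ} (hj : j ≤ n) (huv : ∀ i, j < i → i ≤ n → u i = v i) : ¬ u j < v j := by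
  intro hlt
  obtain ⟨i, hin, hi⟩ := h (v j) (by omega) (hv.le_self hj) ⟨j, hj, rfl⟩
  rcases lt_trichotomy i j with hij | rfl | hij
  · have := hu.lt_of_lt hij (by omega)
    omega
  · omega
  · have := hv.lt_of_lt hij (by omega)
    have := huv i hij hin
    omega

/-- A padded tuple is determined by the set of its positive entries. -/
lemma eq_of_range (hu : IsPaddedTuple n u) (hv : IsPaddedTuple n v)
    (h : ∀ a, 1 ≤ a → a ≤ n → ((∃ i ≤ n, u i = a) ↔ ∃ i ≤ n, v i = a))
    {j : ℕ} (hj : j ≤ n + 1) : u j = v j := by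
  induction hd : n + 1 - j using Nat.strong_induction_on generalizing j with
  | _ d ih =>
    subst hd
    rcases hj.eq_or_lt with rfl | hj
    · rw [hu.last, hv.last]
    · have huv : ∀ i, j < i → i ≤ n → u i = v i := fun i hij hin =>
        ih (n + 1 - i) (by omega) (by omega) rfl
      have h₁ := hu.not_lt_of_range hv (fun a ha han => (h a ha han).2) (by omega) huv
      have h₂ := hv.not_lt_of_range hu (fun a ha han => (h a ha han).1) (by omega)
        (fun i hij hin => (huv i hij hin).symm)
      omega

/-- Winching keeps the order relation with the right neighbour. -/
lemma winchValue_lt (hu : IsPaddedTuple n u) {j : ℕ} (hj : 1 ≤ j) (hjn : j ≤ n) :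
    winchValue (u (j - 1)) (u j) (u (j + 1)) = 0 ∨
      winchValue (u (j - 1)) (u j) (u (j + 1)) < u (j + 1) := by
  have h₁ := hu.step (j - 1) (by omega)
  have h₂ := hu.step j hjn
  rw [Nat.sub_add_cancel hj] at h₁
  unfold winchValue
  split_ifs <;> omega

/-- Winching keeps the order relation with the left neighbour. -/
lemma lt_winchValue (hu : IsPaddedTuple n u) {j : ℕ} (hj : 1 ≤ j) (hjn : j ≤ n) :
    u (j - 1) = 0 ∨ u (j - 1) < winchValue (u (j - 1)) (u j) (u (j + 1)) := by
  have h₁ := hu.step (j - 1) (by omega)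
  rw [Nat.sub_add_cancel hj] at h₁
  unfold winchValue
  split_ifs <;> omega

lemma update (hu : IsPaddedTuple n u) {j : ℕ} (hj : 1 ≤ j) (hjn : j ≤ n) :
    IsPaddedTuple n
      (Function.update u j (winchValue (u (j - 1)) (u j) (u (j + 1)))) where
  zero := by rw [Function.update_of_ne (by omega), hu.zero]
  last := by rw [Function.update_of_ne (by omega), hu.last]
  step i hi := by
    rcases eq_or_ne i j with rfl | hij
    · rw [Function.update_self, Function.update_of_ne (by omega)]
      exact hu.winchValue_lt hj hi
    · rw [Function.update_of_ne hij]
      rcases eq_or_ne (i + 1) j with rfl | hij'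
      · rw [Function.update_self]
        exact hu.lt_winchValue hj hjn
      · rw [Function.update_of_ne hij']
        exact hu.step i hi

/-- The tuple `v` arises from `u` by winching at the indices `n, n - 1, …, 1`, in this order. -/
def Sweeps (n : ℕ) (u v : ℕ → ℕ) : Prop :=
  ∀ j, 1 ≤ j → j ≤ n → v j = winchValue (u (j - 1)) (u j) (v (j + 1))

lemma sweep_of_lt (hu : IsPaddedTuple n u) (hv : IsPaddedTuple n v) (huv : Sweeps n u v)
    (h : u n < n) {j : ℕ} (hj : 1 ≤ j) (hjn : j ≤ n) :
    v j = if u j = 0 ∧ u (j + 1) = 0 then 0 else u j + 1 := by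
  induction hd : n - j generalizing j with
  | zero =>
    obtain rfl : j = n := by omega
    rw [huv j hj hjn, hu.last, hv.last, winchValue, if_pos (by omega), if_neg (by omega)]
  | succ d ih =>
    have h₁ := hu.step (j - 1) (by omega)
    have h₂ := hu.step j hjn
    rw [Nat.sub_add_cancel hj] at h₁
    rw [huv j hj hjn, ih (by omega) (by omega) (by omega), winchValue]
    split_ifs <;> omega

lemma sweep_of_eq (hu : IsPaddedTuple n u) (hv : IsPaddedTuple n v) (huv : Sweeps n u v)
    (h : u n = n) {j : ℕ} (hj : 1 ≤ j) (hjn : j ≤ n) :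
    v j = if u (j - 1) = 0 then 0 else u (j - 1) + 1 := by
  induction hd : n - j generalizing j with
  | zero =>
    obtain rfl : j = n := by omega
    rw [huv j hj hjn, hv.last, winchValue]
    split_ifs <;> omega
  | succ d ih =>
    rw [huv j hj hjn, ih (by omega) (by omega) (by omega), winchValue]
    simp only [Nat.add_sub_cancel]
    split_ifs <;> omega

/-- A sweep increases the entries of a tuple which are less than `n`. -/
lemma sweep_succ_mem (hu : IsPaddedTuple n u) (hv : IsPaddedTuple n v) (huv : Sweeps n u v)
    {a : ℕ} (ha : 1 ≤ a) (han : a < n) :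
    (∃ i ≤ n, v i = a + 1) ↔ ∃ i ≤ n, u i = a := by
  have hle := hu.le_self le_rfl
  have hu0 := hu.zero
  have hv0 := hv.zero
  rcases hle.lt_or_eq with h | h
  · have key := fun j => hu.sweep_of_lt hv huv h (j := j)
    constructor
    · rintro ⟨i, hi, hia⟩
      have hi0 : 1 ≤ i := Nat.one_le_iff_ne_zero.2 (by rintro rfl; omega)
      have := key i hi0 hi
      refine ⟨i, hi, ?_⟩
      split_ifs at this <;> omega
    · rintro ⟨i, hi, hia⟩
      have hi0 : 1 ≤ i := Nat.one_le_iff_ne_zero.2 (by rintro rfl; omega)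
      exact ⟨i, hi, by rw [key i hi0 hi, if_neg (by omega), hia]⟩
  · have key := fun j => hu.sweep_of_eq hv huv h (j := j)
    constructor
    · rintro ⟨i, hi, hia⟩
      have hi0 : 1 ≤ i := Nat.one_le_iff_ne_zero.2 (by rintro rfl; omega)
      have := key i hi0 hi
      refine ⟨i - 1, by omega, ?_⟩
      split_ifs at this <;> omega
    · rintro ⟨i, hi, hia⟩
      have hin : i ≠ n := by rintro rfl; omega
      exact ⟨i + 1, by omega, by
        rw [key (i + 1) (by omega) (by omega), Nat.add_sub_cancel, if_neg (by omega), hia]⟩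

/-- A sweep creates the entry `1` exactly when `n` is not an entry. -/
lemma sweep_one_mem (hu : IsPaddedTuple n u) (hv : IsPaddedTuple n v) (huv : Sweeps n u v)
    (hn : 1 ≤ n) : (∃ i ≤ n, v i = 1) ↔ ¬ ∃ i ≤ n, u i = n := by
  have hle := hu.le_self le_rfl
  rcases hle.lt_or_eq with h | h
  · refine iff_of_true ?_ ?_
    · have h1 : u 1 = 0 := by
        by_contra h1
        have := hu.self_le h1 hn le_rfl
        omega
      have hex : ∃ j, u (j + 1) ≠ 0 := ⟨n, by rw [hu.last]; omega⟩
      have hmin : ∀ i < Nat.find hex, u (i + 1) = 0 := fun i hi =>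
        not_not.1 (Nat.find_min hex hi)
      have hspec := Nat.find_spec hex
      have hfn : Nat.find hex ≤ n := Nat.find_min' hex (by rw [hu.last]; omega)
      generalize Nat.find hex = j at hspec hmin hfn
      have hj : 1 ≤ j := by
        by_contra
        obtain rfl : j = 0 := by omega
        exact hspec h1
      have hj0 := hmin (j - 1) (by omega)
      rw [Nat.sub_add_cancel hj] at hj0
      exact ⟨j, hfn, by
        rw [hu.sweep_of_lt hv huv h hj hfn, if_neg (fun h => hspec h.2), hj0]⟩
    · rintro ⟨i, hi, hin⟩
      rcases hi.eq_or_lt with rfl | hi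
      · omega
      · have := hu.lt_of_lt hi (by omega)
        omega
  · refine iff_of_false ?_ (not_not.2 ⟨n, le_rfl, h⟩)
    rintro ⟨i, hi, hi1⟩
    have hv0 := hv.zero
    have hi0 : 1 ≤ i := Nat.one_le_iff_ne_zero.2 (by rintro rfl; omega)
    have := hu.sweep_of_eq hv huv h hi0 hi
    split_ifs at this <;> omega

/-- Sweeping has period `2 * n`: it acts on the indicator word of the set of entries as a shift
which feeds back the complement of the last letter. -/
lemma sweep_period {W : ℕ → ℕ → ℕ} (hW : ∀ t, IsPaddedTuple n (W t))
    (hs : ∀ t, Sweeps n (W t) (W (t + 1))) (t : ℕ) {j : ℕ} (hj : j ≤ n + 1) :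
    W (t + 2 * n) j = W t j := by
  have shift : ∀ d t a, 1 ≤ a → a + d ≤ n →
      ((∃ i ≤ n, W (t + d) i = a + d) ↔ ∃ i ≤ n, W t i = a) := by
    intro d
    induction d with
    | zero => intro t a _ _; rfl
    | succ d ih =>
      intro t a ha had
      rw [← ih t a ha (by omega)]
      exact (hW (t + d)).sweep_succ_mem (a := a + d) (hW _) (hs _) (by omega) (by omega)
  have flip : ∀ t a, 1 ≤ a → a ≤ n →
      ((∃ i ≤ n, W (t + n) i = a) ↔ ¬ ∃ i ≤ n, W t i = a) := by
    intro t a ha han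
    have h₁ := shift (n - a) t a ha (by omega)
    have h₂ := shift (a - 1) (t + (n - a) + 1) 1 le_rfl (by omega)
    have h₃ := (hW (t + (n - a))).sweep_one_mem (hW _) (hs _) (by omega)
    rw [show a + (n - a) = n by omega] at h₁
    rw [show t + (n - a) + 1 + (a - 1) = t + n by omega, show 1 + (a - 1) = a by omega] at h₂
    rw [h₂, h₃, h₁]
  refine (hW _).eq_of_range (hW t) (fun a ha han => ?_) hj
  rw [show t + 2 * n = t + n + n by ring, flip _ a ha han, flip t a ha han, not_not]

end IsPaddedTuple

/-- The tuples `X 0, X 1, …` arise by winching at one index at a time, where the index `j` is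
used at the times which are congruent to `p j` modulo `n`. -/
structure IsWinchOrbit (n : ℕ) (p : ℕ → ℕ) (X : ℕ → ℕ → ℕ) : Prop where
  lt : ∀ j, 1 ≤ j → j ≤ n → p j < n
  ne : ∀ j, 1 ≤ j → j < n → p j ≠ p (j + 1)
  padded : ∀ k, IsPaddedTuple n (X k)
  winch : ∀ k j, 1 ≤ j → j ≤ n → k % n = p j →
    X (k + 1) j = winchValue (X k (j - 1)) (X k j) (X k (j + 1))
  fixed : ∀ k j, 1 ≤ j → j ≤ n → k % n ≠ p j → X (k + 1) j = X k j

namespace IsWinchOrbit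

variable {n : ℕ} {p : ℕ → ℕ} {X : ℕ → ℕ → ℕ}

lemma eq_of_between (h : IsWinchOrbit n p X) {j m k : ℕ} (hj : j ≤ n + 1)
    (hm : 1 ≤ j → j ≤ n → m % n = p j) (hmk : m < k) (hkm : k ≤ m + n) :
    X k j = X (m + 1) j := by
  by_cases hj' : 1 ≤ j ∧ j ≤ n
  · obtain ⟨h1, hn⟩ := hj'
    induction k, hmk using Nat.le_induction with
    | base => rfl
    | succ k hmk ih =>
      rw [← ih (by omega)]
      refine h.fixed k j h1 hn fun hk => ?_
      rw [← hm h1 hn] at hk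
      have hdvd := (Nat.modEq_iff_dvd' (by omega : m ≤ k)).1 hk.symm
      have := Nat.le_of_dvd (by omega) hdvd
      omega
  · have : j = 0 ∨ j = n + 1 := by omega
    rcases this with rfl | rfl
    · rw [(h.padded _).zero, (h.padded _).zero]
    · rw [(h.padded _).last, (h.padded _).last]

/-- There are times at which the indices `n, n - 1, …, 1` are used in this order, each less than
`n` steps after its predecessor. -/
lemma exists_times (h : IsWinchOrbit n p X) : ∃ τ : ℕ → ℕ,
    (∀ j, 1 ≤ j → j ≤ n → τ j % n = p j) ∧
    ∀ j, 1 ≤ j → j < n → τ (j + 1) < τ j ∧ τ j < τ (j + 1) + n := by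
  refine ⟨fun j => p j + n * ∑ i ∈ Finset.Ico j n, if p i < p (i + 1) then 1 else 0,
    fun j h1 hn => ?_, fun j h1 hn => ?_⟩
  · simp only [Nat.add_mul_mod_self_left]
    exact Nat.mod_eq_of_lt (h.lt j h1 hn)
  · simp only [Finset.sum_eq_sum_Ico_succ_bot hn, mul_add]
    have := h.lt j h1 hn.le
    have := h.lt (j + 1) (by omega) hn
    have := h.ne j h1 hn
    split_ifs <;> omega

lemma eventually_period (h : IsWinchOrbit n p X) (hn : 1 ≤ n) :
    ∃ K, ∀ k ≥ K, ∀ j ≤ n + 1, X (k + n * (2 * n)) j = X k j := by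
  obtain ⟨τ, hτ, hτ'⟩ := h.exists_times
  have hmod : ∀ t j, 1 ≤ j → j ≤ n → (τ j + n * t) % n = p j := fun t j h1 hj => by
    rw [Nat.add_mul_mod_self_left, hτ j h1 hj]
  have hnext : ∀ t j m, j ≤ n + 1 → (1 ≤ j → j ≤ n → τ j + n * t < m ∧ m ≤ τ j + n * (t + 1)) →
      X m j = X (τ j + n * (t + 1)) j := by
    intro t j m hj hm
    by_cases hj' : 1 ≤ j ∧ j ≤ n
    · have hm := hm hj'.1 hj'.2
      rw [mul_add_one] at hm ⊢
      rw [h.eq_of_between hj (hmod t j) hm.1 (by omega),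
        h.eq_of_between (k := τ j + (n * t + n)) hj (hmod t j) (by omega) (by omega)]
    · have : j = 0 ∨ j = n + 1 := by omega
      rcases this with rfl | rfl
      · rw [(h.padded _).zero, (h.padded _).zero]
      · rw [(h.padded _).last, (h.padded _).last]
  set W : ℕ → ℕ → ℕ := fun t j => X (τ j + n * (t + 1)) j
  have hW : ∀ t, IsPaddedTuple n (W t) := by
    refine fun t => ⟨(h.padded _).zero, (h.padded _).last, fun j hj => ?_⟩
    rcases Nat.eq_zero_or_pos j with rfl | h1
    · exact Or.inl (h.padded _).zero
    · have hstep := (h.padded (τ (j + 1) + n * (t + 1))).step j hj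
      rcases hj.eq_or_lt with rfl | hj
      · simp only [W]
        rw [(h.padded _).last]
        have := (h.padded (τ j + j * (t + 1))).le_self le_rfl
        omega
      · have := hτ' j h1 hj
        rwa [hnext t j _ (by omega) fun _ _ => by rw [mul_add_one]; omega] at hstep
  have hs : ∀ t, IsPaddedTuple.Sweeps n (W t) (W (t + 1)) := by
    intro t j h1 hj
    have hw := h.winch (τ j + n * (t + 1)) j h1 hj (hmod _ j h1 hj)
    rw [hnext (t + 1) j _ (by omega) fun _ _ => by rw [mul_add_one n (t + 1)]; omega] at hw
    refine hw.trans ?_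
    congr 1
    · refine hnext t (j - 1) _ (by omega) fun h1' _ => ?_
      have := hτ' (j - 1) h1' (by omega)
      rw [Nat.sub_add_cancel h1] at this
      rw [mul_add_one]
      omega
    · refine hnext (t + 1) (j + 1) _ (by omega) fun _ hj' => ?_
      have := hτ' j h1 (by omega)
      rw [mul_add_one n (t + 1)]
      omega
  refine ⟨∑ i ∈ Finset.range (n + 2), (τ i + 1), fun k hk j hj => ?_⟩
  have hle : τ j + 1 ≤ k := (Finset.single_le_sum (f := fun i => τ i + 1) (fun _ _ => by omega)
    (Finset.mem_range.2 (by omega))).trans hk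
  obtain ⟨t, ht⟩ : ∃ t, τ j + n * t < k ∧ k ≤ τ j + n * (t + 1) := by
    refine ⟨(k - τ j - 1) / n, ?_⟩
    have h₁ := Nat.div_add_mod (k - τ j - 1) n
    have h₂ := Nat.mod_lt (k - τ j - 1) hn
    rw [mul_add_one]
    omega
  rw [hnext t j k hj fun _ _ => ht, hnext (t + 2 * n) j (k + n * (2 * n)) hj fun _ _ => by
    simp only [mul_add] at ht ⊢
    omega]
  exact IsPaddedTuple.sweep_period hW hs t hj

end IsWinchOrbit

/-- The tuple `x`, indexed from `1` and with the boundary entries `0` and `n + 1` added. -/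
def padZ (n : ℕ) (x : Fin n → ℕ) : ℕ → ℕ
  | 0 => 0
  | j + 1 => extZ n x j

section padZ

variable {n : ℕ} {x y : Fin n → ℕ}

lemma padZ_succ (x : Fin n → ℕ) (i : Fin n) : padZ n x (i + 1) = x i := by
  simp [padZ, extZ]

lemma eq_of_padZ_eq (h : ∀ j, padZ n x j = padZ n y j) : x = y :=
  funext fun i => by rw [← padZ_succ x, h, padZ_succ]

lemma isPaddedTuple_padZ_iff : IsPaddedTuple n (padZ n x) ↔ SZmem n x := by
  constructor
  · intro h
    refine ⟨fun i => ?_, fun i j hij => ?_⟩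
    · rw [← padZ_succ x]
      exact h.le_self (by omega)
    · rw [← padZ_succ x i, ← padZ_succ x j]
      exact h.lt_of_lt (by simpa using hij) (by omega)
  · intro h
    refine ⟨rfl, by simp [padZ, extZ], fun j hj => ?_⟩
    rcases j with _ | j
    · exact Or.inl rfl
    · rcases hj.eq_or_lt with hj' | hj'
      · have := h.1 ⟨j, by omega⟩
        simp only [padZ, extZ, dif_pos (show j < n by omega), dif_neg (show ¬ j + 1 < n by omega)]
        omega
      · simpa [padZ, extZ, hj', show j < n by omega] using
          h.2 ⟨j, by omega⟩ ⟨j + 1, hj'⟩ (by simp)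

lemma padZ_winchZ (hx : SZmem n x) (i : Fin n) :
    padZ n (winchZ n i x) = Function.update (padZ n x) (i + 1)
      (winchValue (padZ n x i) (padZ n x (i + 1)) (padZ n x (i + 2))) := by
  have hle : extZ n x (i + 1) ≤ n + 1 := by
    unfold extZ
    split_ifs with h
    · exact (hx.1 _).trans (by omega)
    · exact le_rfl
  have hi : winchZ n i x i =
      winchValue (padZ n x i) (padZ n x (i + 1)) (padZ n x (i + 2)) := by
    rw [padZ_succ]
    obtain ⟨i, hin⟩ := i
    rw [winchZ, if_pos rfl, min_eq_left hle, winchValue]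
    rcases i with _ | i
    · simp [padZ]
    · simp [padZ, extZ, show i < n by omega]
  funext j
  rcases eq_or_ne j (i + 1) with rfl | hj
  · rw [Function.update_self, padZ_succ, hi]
  · rw [Function.update_of_ne hj]
    rcases j with _ | j
    · rfl
    · have hji : j ≠ i := by omega
      simp only [padZ, extZ]
      split_ifs with h
      · exact if_neg fun h' => hji (congrArg Fin.val h')
      · rfl

lemma SZmem.winchZ (hx : SZmem n x) (i : Fin n) : SZmem n (winchZ n i x) := by
  rw [← isPaddedTuple_padZ_iff, padZ_winchZ hx]
  exact (isPaddedTuple_padZ_iff.2 hx).update (by omega) (by omega)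

lemma winchZ_injOn (i : Fin n) : Set.InjOn (winchZ n i) {x | SZmem n x} := by
  intro x hx y hy hxy
  have hne : ∀ j, j ≠ i → x j = y j := fun j hj => by
    simpa [winchZ, hj] using congrFun hxy j
  have hpad : ∀ j, j ≠ (i : ℕ) + 1 → padZ n x j = padZ n y j := fun j hj => by
    have := congrFun (congrArg (padZ n) hxy) j
    rwa [padZ_winchZ hx, padZ_winchZ hy, Function.update_of_ne hj,
      Function.update_of_ne hj] at this
  have hval := congrFun (congrArg (padZ n) hxy) (i + 1)
  rw [padZ_winchZ hx, padZ_winchZ hy, Function.update_self, Function.update_self,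
    hpad i (by omega), hpad (i + 2) (by omega)] at hval
  have hx' := isPaddedTuple_padZ_iff.2 hx
  have hy' := isPaddedTuple_padZ_iff.2 hy
  have h₁ := hx'.step i (by omega)
  have h₂ : padZ n x (i + 1) = 0 ∨ padZ n x (i + 1) < padZ n x (i + 2) :=
    hx'.step (i + 1) (by omega)
  have h₃ := hy'.step i (by omega)
  have h₄ : padZ n y (i + 1) = 0 ∨ padZ n y (i + 1) < padZ n y (i + 2) :=
    hy'.step (i + 1) (by omega)
  rw [hpad i (by omega)] at h₁
  rw [hpad (i + 2) (by omega)] at h₂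
  refine eq_of_padZ_eq fun j => ?_
  rcases eq_or_ne j (i + 1) with rfl | hj
  · unfold winchValue at hval
    split_ifs at hval <;> omega
  · exact hpad j hj

end padZ

/-- The tuple obtained from `x` by the first `k` of the winchings which make up the iterates
of `winchZPerm n ν`. -/
def winchOrbit (n : ℕ) (hn : 0 < n) (ν : Equiv.Perm (Fin n)) (x : Fin n → ℕ) : ℕ → Fin n → ℕ
  | 0 => x
  | k + 1 => winchZ n (ν ⟨k % n, Nat.mod_lt k hn⟩) (winchOrbit n hn ν x k)

section winchOrbit

variable {n : ℕ} {x : Fin n → ℕ}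

lemma winchOrbit_mem (hn : 0 < n) (ν : Equiv.Perm (Fin n)) (hx : SZmem n x) (k : ℕ) :
    SZmem n (winchOrbit n hn ν x k) := by
  induction k with
  | zero => exact hx
  | succ k ih => exact ih.winchZ _

lemma winchOrbit_mul_add (hn : 0 < n) (ν : Equiv.Perm (Fin n)) (t : ℕ) {m : ℕ}
    (hm : m ≤ n) :
    winchOrbit n hn ν x (n * t + m) = ((List.finRange n).take m).foldl
      (fun y t => winchZ n (ν t) y) (winchOrbit n hn ν x (n * t)) := by
  induction m with
  | zero => rfl
  | succ m ih =>
    rw [List.take_succ_eq_append_getElem (by simpa using hm), List.foldl_append, ← ih (by omega),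
      ← add_assoc, winchOrbit]
    simp [Nat.mod_eq_of_lt (show m < n by omega)]

lemma iterate_winchZPerm (hn : 0 < n) (ν : Equiv.Perm (Fin n)) (t : ℕ) :
    (winchZPerm n ν)^[t] x = winchOrbit n hn ν x (n * t) := by
  induction t with
  | zero => rfl
  | succ t ih =>
    rw [Function.iterate_succ_apply', ih, mul_add_one, winchOrbit_mul_add hn ν t le_rfl,
      winchZPerm, List.take_of_length_le (by simp)]
    rfl

lemma winchZPerm_mapsTo (hn : 0 < n) (ν : Equiv.Perm (Fin n)) :
    Set.MapsTo (winchZPerm n ν) {x | SZmem n x} {x | SZmem n x} := by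
  intro x hx
  rw [← Function.iterate_one (winchZPerm n ν), iterate_winchZPerm hn]
  exact winchOrbit_mem hn ν hx _

lemma winchZPerm_injOn (hn : 0 < n) (ν : Equiv.Perm (Fin n)) :
    Set.InjOn (winchZPerm n ν) {x | SZmem n x} := by
  intro x hx y hy hxy
  rw [← Function.iterate_one (winchZPerm n ν), iterate_winchZPerm hn, iterate_winchZPerm hn] at hxy
  generalize n * 1 = k at hxy
  induction k with
  | zero => exact hxy
  | succ k ih =>
    exact ih (winchZ_injOn _ (winchOrbit_mem hn ν hx k) (winchOrbit_mem hn ν hy k) hxy)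

lemma isWinchOrbit_winchOrbit (hn : 0 < n) (ν : Equiv.Perm (Fin n)) (hx : SZmem n x) :
    IsWinchOrbit n (fun j => if h : j - 1 < n then ν.symm ⟨j - 1, h⟩ else 0)
      (fun k => padZ n (winchOrbit n hn ν x k)) where
  lt j h1 hj := by
    rw [dif_pos (by omega)]
    exact Fin.isLt _
  ne j h1 hj h := by
    rw [dif_pos (by omega), dif_pos (by omega)] at h
    have := ν.symm.injective (Fin.ext h)
    simp only [Fin.mk.injEq] at this
    omega
  padded k := isPaddedTuple_padZ_iff.2 (winchOrbit_mem hn ν hx k)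
  winch k j h1 hj hk := by
    rw [dif_pos (by omega)] at hk
    have hν : ν ⟨k % n, Nat.mod_lt k hn⟩ = ⟨j - 1, by omega⟩ := by
      rw [← Equiv.eq_symm_apply]
      exact Fin.ext hk
    simp only [winchOrbit]
    rw [padZ_winchZ (winchOrbit_mem hn ν hx k), hν]
    obtain ⟨j, rfl⟩ := Nat.exists_eq_add_of_le' h1
    exact Function.update_self ..
  fixed k j h1 hj hk := by
    rw [dif_pos (by omega)] at hk
    simp only [winchOrbit]
    rw [padZ_winchZ (winchOrbit_mem hn ν hx k), Function.update_of_ne]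
    rintro rfl
    simp at hk

end winchOrbit

/-- the `2n`-th iterate of `WZ_ν` is the identity on `S_n`. -/
theorem stmt_10 (n : ℕ) (hn : 1 ≤ n) (ν : Equiv.Perm (Fin n))
    (x : Fin n → ℕ) (hx : SZmem n x) :
    (winchZPerm n ν)^[2 * n] x = x := by
  obtain ⟨K, hK⟩ := (isWinchOrbit_winchOrbit hn ν hx).eventually_period hn
  have hmaps := winchZPerm_mapsTo hn ν
  refine (winchZPerm_injOn hn ν).iterate hmaps K (hmaps.iterate (2 * n) hx) hx ?_
  rw [← Function.iterate_add_apply, iterate_winchZPerm hn, iterate_winchZPerm hn, mul_add]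
  refine eq_of_padZ_eq fun j => ?_
  by_cases hj : j ≤ n + 1
  · exact hK (n * K) (Nat.le_mul_of_pos_left K hn) j hj
  · obtain ⟨j, rfl⟩ := Nat.exists_eq_add_of_le' (show 1 ≤ j by omega)
    simp [padZ, extZ, show ¬ j < n by omega]
end

section
/- Let n ≥ 1. The crawl map C sends M_n into M_n, and for every c ∈ M_n the n-th iterate of the crawl map is the identity: C^n(c) = c. -/
-- The set `M_n` of snake maps: tuples `(c_1, …, c_n)` of nonnegative integers with a
-- prefix of zeros (possibly empty), all remaining entries positive, and total sum `n`.
-- (Zeros forming a prefix is expressed by: an entry equal to `0` forces all earlier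
-- entries to be `0`; the prefix is proper since the sum is `n ≥ 1`.)
def Mmem (n : ℕ) (c : Fin n → ℕ) : Prop :=
  (∑ i, c i = n) ∧ ∀ i j : Fin n, i ≤ j → c j = 0 → c i = 0

-- The crawl map `C`: for `1 ≤ i ≤ n−1` (1-based), `c'_i = max(0, c_{i+1} − 1)` if
-- `c_1, …, c_i` are all `≤ 1` and `c'_i = c_{i+1}` otherwise; and
-- `c'_n = n − (c'_1 + … + c'_{n−1})`.  (0-based indexing below; `max(0, · − 1)` is
-- truncated subtraction on `ℕ`.)
def crawl (n : ℕ) (c : Fin n → ℕ) : Fin n → ℕ := fun i =>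
  let c' : Fin n → ℕ := fun t =>
    if h : t.val + 1 < n then
      (if ∀ s : Fin n, s ≤ t → c s ≤ 1 then c ⟨t.val + 1, h⟩ - 1 else c ⟨t.val + 1, h⟩)
    else 0
  if i.val + 1 < n then c' i else n - ∑ t, c' t

/-- The number of indices `j < n` with `f j ≤ t`. -/
def countLE (n : ℕ) (f : ℕ → ℕ) (t : ℕ) : ℕ := ∑ j ∈ Finset.range n, if f j ≤ t then 1 else 0

/-- Extension of `f` from `[0, n)` to `[0, 2n)` whose windows of length `n` encode the orbit
of the crawl map. -/
def orbitProfile (n : ℕ) (f : ℕ → ℕ) (j : ℕ) : ℕ :=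
  if j < n then f j else countLE n f (j - n) + f (j - n)

section Profile

variable {n : ℕ} {f : ℕ → ℕ}

lemma countLE_le (n : ℕ) (f : ℕ → ℕ) (t : ℕ) : countLE n f t ≤ n := by
  unfold countLE
  calc _ ≤ ∑ j ∈ Finset.range n, 1 := Finset.sum_le_sum fun j _ => by split_ifs <;> simp
    _ = n := by simp

lemma countLE_le_iff (hf : Monotone f) {t u : ℕ} (ht : t < n) :
    countLE n f u ≤ t ↔ u < f t := by
  unfold countLE
  rw [← Finset.card_filter]
  constructor
  · intro h
    by_contra! hu
    have hsub : Finset.range (t + 1) ⊆ (Finset.range n).filter (fun j => f j ≤ u) := by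
      intro j hj
      simp only [Finset.mem_range, Finset.mem_filter] at hj ⊢
      exact ⟨by omega, (hf (by omega : j ≤ t)).trans hu⟩
    have := Finset.card_le_card hsub
    simp only [Finset.card_range] at this
    omega
  · intro h
    have hsub : (Finset.range n).filter (fun j => f j ≤ u) ⊆ Finset.range t := by
      intro j hj
      simp only [Finset.mem_range, Finset.mem_filter] at hj ⊢
      by_contra! hjt
      have := hf hjt
      omega
    simpa using Finset.card_le_card hsub

lemma countLE_eq (hf : Monotone f) {u : ℕ} (hu : f (n - 1) ≤ u) : countLE n f u = n := by
  rcases Nat.eq_zero_or_pos n with rfl | hn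
  · simp [countLE]
  have h1 := countLE_le n f u
  have h2 := (countLE_le_iff (n := n) (u := u) hf (show n - 1 < n by omega)).not
  omega

lemma apply_le_self (hf : Monotone f) (h0 : ∀ i < f (n - 1), f i = 0) {i : ℕ} (hi : i < n) :
    f i ≤ i := by
  by_cases h : i < f (n - 1)
  · simp [h0 i h]
  · have := hf (show i ≤ n - 1 by omega)
    omega

lemma orbitProfile_add_sub (hf : Monotone f) (h0 : ∀ i < f (n - 1), f i = 0) (i : ℕ) :
    orbitProfile n f (i + n) - n = f i := by
  simp only [orbitProfile, show ¬ i + n < n by omega, if_false, Nat.add_sub_cancel]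
  by_cases h : i < f (n - 1)
  · have := countLE_le n f i
    have := h0 i h
    omega
  · have := countLE_eq (n := n) hf (not_lt.mp h)
    omega

lemma countLE_orbitProfile (hf : Monotone f) (h0 : ∀ i < f (n - 1), f i = 0) {t : ℕ}
    (ht : t < n) :
    countLE n (fun i => orbitProfile n f (i + t) - t) 0 + t = countLE n f t + f t := by
  obtain ⟨m, rfl⟩ := Nat.exists_eq_add_of_lt ht
  set n := t + m + 1 with hn
  have hsplit : ∀ g : ℕ → ℕ, ∑ j ∈ Finset.range n, g j =
      ∑ j ∈ Finset.range t, g j + ∑ j ∈ Finset.range (m + 1), g (t + j) := fun g => by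
    rw [hn, add_assoc, Finset.sum_range_add]
  have hsplit' : ∀ g : ℕ → ℕ, ∑ j ∈ Finset.range n, g j =
      ∑ j ∈ Finset.range (m + 1), g j + ∑ j ∈ Finset.range t, g (m + 1 + j) := fun g => by
    rw [hn, show t + m + 1 = (m + 1) + t by omega, Finset.sum_range_add]
  have hleft : countLE n f t = t + ∑ j ∈ Finset.range (m + 1), if f (t + j) ≤ t then 1 else 0 := by
    unfold countLE
    rw [hsplit]
    congr 1
    rw [Finset.sum_congr rfl (g := fun _ => 1)]
    · simp
    · intro j hj
      rw [Finset.mem_range] at hj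
      have := apply_le_self hf h0 (show j < n by omega)
      rw [if_pos (by omega)]
  have hlow : ∑ j ∈ Finset.range t, (if orbitProfile n f (m + 1 + j + t) - t ≤ 0 then 1 else 0)
      = f t := by
    rw [← Finset.card_filter]
    have : (Finset.range t).filter (fun j => orbitProfile n f (m + 1 + j + t) - t ≤ 0)
        = Finset.range (f t) := by
      ext u
      simp only [Finset.mem_filter, Finset.mem_range]
      rw [show m + 1 + u + t = u + n by omega]
      simp only [orbitProfile, show ¬ u + n < n by omega, if_false, Nat.add_sub_cancel]
      have h1 := countLE_le_iff (u := u) hf ht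
      have h2 := apply_le_self hf h0 ht
      have h3 : f t ≤ f (n - 1) := hf (by omega)
      constructor
      · rintro ⟨_, h⟩
        exact h1.mp (by omega)
      · intro h
        have h4 := h0 u (by omega)
        have h5 := h1.mpr h
        omega
    rw [this, Finset.card_range]
  have hright : countLE n (fun i => orbitProfile n f (i + t) - t) 0 =
      (∑ j ∈ Finset.range (m + 1), if f (t + j) ≤ t then 1 else 0) + f t := by
    rw [← hlow]
    unfold countLE
    rw [hsplit']
    congr 1
    refine Finset.sum_congr rfl fun j hj => ?_
    rw [Finset.mem_range] at hj
    simp only [orbitProfile, show t + j < n by omega, if_true, add_comm j t, Nat.le_zero,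
      Nat.sub_eq_zero_iff_le]
  omega

end Profile

/-- Extension of a tuple by zero to all of `ℕ`. -/
def extendZero {n : ℕ} (c : Fin n → ℕ) (i : ℕ) : ℕ := if h : i < n then c ⟨i, h⟩ else 0

/-- Partial sums of the truncated excesses `c_s - 1`. -/
def excess {n : ℕ} (c : Fin n → ℕ) (i : ℕ) : ℕ :=
  ∑ s ∈ Finset.range (i + 1), (extendZero c s - 1)

section Snake

variable {n : ℕ} {c : Fin n → ℕ}

lemma extendZero_val (c : Fin n → ℕ) (i : Fin n) : extendZero c i = c i := by
  simp [extendZero]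

lemma sum_extendZero (c : Fin n → ℕ) : ∑ i ∈ Finset.range n, extendZero c i = ∑ i, c i := by
  rw [← Fin.sum_univ_eq_sum_range]
  simp [extendZero_val]

lemma excess_succ (c : Fin n → ℕ) (i : ℕ) :
    excess c (i + 1) = excess c i + (extendZero c (i + 1) - 1) := by
  rw [excess, Finset.sum_range_succ, excess]

lemma excess_monotone (c : Fin n → ℕ) : Monotone (excess c) :=
  monotone_nat_of_le_succ fun i => by rw [excess_succ]; omega

lemma excess_eq_zero_iff (c : Fin n → ℕ) (i : ℕ) :
    excess c i = 0 ↔ ∀ s ≤ i, extendZero c s ≤ 1 := by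
  simp only [excess, Finset.sum_eq_zero_iff, Finset.mem_range, Nat.lt_succ_iff,
    Nat.sub_eq_zero_iff_le]

lemma Mmem.sum_extendZero (hc : Mmem n c) : ∑ i ∈ Finset.range n, extendZero c i = n := by
  rw [_root_.sum_extendZero, hc.1]

lemma Mmem.extendZero_eq_zero (hc : Mmem n c) {i j : ℕ} (hij : i ≤ j) (hj : j < n)
    (h : extendZero c j = 0) : extendZero c i = 0 := by
  have hi : i < n := by omega
  simp only [extendZero, hi, hj, dif_pos] at h ⊢
  exact hc.2 ⟨i, hi⟩ ⟨j, hj⟩ hij h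

lemma Mmem.excess_last (hn : 1 ≤ n) (hc : Mmem n c) :
    excess c (n - 1) = countLE n (extendZero c) 0 := by
  have h : ∀ x : ℕ, x - 1 + 1 = x + if x ≤ 0 then 1 else 0 := fun x => by
    split_ifs <;> omega
  have hsum : ∑ s ∈ Finset.range n, (extendZero c s - 1 + 1) =
      ∑ s ∈ Finset.range n, (extendZero c s + if extendZero c s ≤ 0 then 1 else 0) :=
    Finset.sum_congr rfl fun s _ => h _
  rw [Finset.sum_add_distrib, Finset.sum_add_distrib, hc.sum_extendZero] at hsum
  simp only [Finset.sum_const, Finset.card_range, smul_eq_mul, mul_one] at hsum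
  unfold excess countLE
  rw [Nat.sub_add_cancel hn]
  omega

lemma Mmem.extendZero_eq_zero_iff (hc : Mmem n c) {i : ℕ} (hi : i < n) :
    extendZero c i = 0 ↔ i < excess c (n - 1) := by
  rw [hc.excess_last (by omega), countLE, ← Finset.card_filter]
  constructor
  · intro h
    have hsub : Finset.range (i + 1) ⊆
        (Finset.range n).filter (fun j => extendZero c j ≤ 0) := by
      intro j hj
      simp only [Finset.mem_range, Finset.mem_filter] at hj ⊢
      exact ⟨by omega, (hc.extendZero_eq_zero (by omega) hi h).le⟩
    have := Finset.card_le_card hsub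
    simp only [Finset.card_range] at this
    omega
  · intro h
    by_contra hne
    have hsub : (Finset.range n).filter (fun j => extendZero c j ≤ 0) ⊆ Finset.range i := by
      intro j hj
      simp only [Finset.mem_range, Finset.mem_filter] at hj ⊢
      by_contra! hij
      exact hne (hc.extendZero_eq_zero hij hj.1 (by omega))
    have := Finset.card_le_card hsub
    simp only [Finset.card_range] at this
    omega

lemma Mmem.excess_last_lt (hn : 1 ≤ n) (hc : Mmem n c) : excess c (n - 1) < n := by
  by_contra! h
  have hz : ∑ i ∈ Finset.range n, extendZero c i = 0 := Finset.sum_eq_zero fun i hi => by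
    rw [Finset.mem_range] at hi
    exact (hc.extendZero_eq_zero_iff hi).mpr (by omega)
  rw [hc.sum_extendZero] at hz
  omega

lemma Mmem.extendZero_zero_le (hn : 1 ≤ n) (hc : Mmem n c) : extendZero c 0 ≤ 1 := by
  by_contra! h
  have hlt : ∑ i ∈ Finset.range n, 1 < ∑ i ∈ Finset.range n, extendZero c i := by
    refine Finset.sum_lt_sum (fun i hi => ?_) ⟨0, Finset.mem_range.mpr hn, h⟩
    by_contra! hi0
    have := hc.extendZero_eq_zero (Nat.zero_le i) (Finset.mem_range.mp hi) (by omega)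
    omega
  rw [hc.sum_extendZero] at hlt
  simp at hlt

lemma Mmem.excess_zero (hn : 1 ≤ n) (hc : Mmem n c) : excess c 0 = 0 := by
  rw [excess_eq_zero_iff]
  intro s hs
  rw [Nat.le_zero.mp hs]
  exact hc.extendZero_zero_le hn

lemma Mmem.excess_eq_zero (hc : Mmem n c) {i : ℕ} (h : i < excess c (n - 1)) :
    excess c i = 0 := by
  rcases Nat.eq_zero_or_pos n with rfl | hn
  · simp [excess, extendZero]
  rw [excess_eq_zero_iff]
  intro s hs
  have := hc.excess_last_lt hn
  rw [(hc.extendZero_eq_zero_iff (by omega)).mpr (by omega)]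
  omega

lemma Mmem.eq_of_excess_eq {d : Fin n → ℕ} (hc : Mmem n c) (hd : Mmem n d)
    (h : ∀ i < n, excess c i = excess d i) : c = d := by
  funext i
  rw [← extendZero_val c, ← extendZero_val d]
  have hi := i.2
  have h1 := hc.extendZero_eq_zero_iff hi
  have h2 := hd.extendZero_eq_zero_iff hi
  have h3 := h (n - 1) (by omega)
  have hsub : extendZero c i - 1 = extendZero d i - 1 := by
    have h4 := h i hi
    rcases hi' : (i : ℕ) with _ | j
    · simpa [hi', excess] using h4
    · rw [hi', excess_succ, excess_succ, h j (by omega)] at h4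
      omega
  omega

lemma extendZero_crawl (c : Fin n → ℕ) {i : ℕ} (hi : i + 1 < n) :
    extendZero (crawl n c) i =
      if excess c i = 0 then extendZero c (i + 1) - 1 else extendZero c (i + 1) := by
  have hiff : (∀ s : Fin n, s ≤ (⟨i, by omega⟩ : Fin n) → c s ≤ 1) ↔ excess c i = 0 := by
    rw [excess_eq_zero_iff]
    constructor
    · intro h s hs
      have := h ⟨s, by omega⟩ hs
      rwa [← extendZero_val c] at this
    · intro h s hs
      rw [← extendZero_val c]
      exact h s hs
  simp only [extendZero, show i < n by omega, dif_pos, crawl, hi, if_true, hiff]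

lemma extendZero_crawl_last (m : ℕ) (c : Fin (m + 1) → ℕ) :
    extendZero (crawl (m + 1) c) m =
      m + 1 - ∑ i ∈ Finset.range m, extendZero (crawl (m + 1) c) i := by
  have hlast : extendZero (crawl (m + 1) c) m = crawl (m + 1) c (Fin.last m) :=
    extendZero_val _ (Fin.last m)
  rw [hlast, crawl]
  simp only [Fin.val_last, lt_irrefl, if_false]
  congr 1
  rw [Fin.sum_univ_castSucc]
  simp only [Fin.val_last, lt_irrefl, dif_neg, not_false_eq_true, add_zero]
  rw [← Fin.sum_univ_eq_sum_range]
  refine Finset.sum_congr rfl fun i _ => ?_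
  have : extendZero (crawl (m + 1) c) i = crawl (m + 1) c i.castSucc :=
    extendZero_val _ i.castSucc
  rw [this, crawl]
  simp

lemma Mmem.sum_crawl_lt {m : ℕ} {c : Fin (m + 1) → ℕ} (hc : Mmem (m + 1) c) :
    ∑ i ∈ Finset.range m, extendZero (crawl (m + 1) c) i < m + 1 := by
  have hle : ∀ i ∈ Finset.range m,
      extendZero (crawl (m + 1) c) i ≤ extendZero c (i + 1) := fun i hi => by
    rw [Finset.mem_range] at hi
    rw [extendZero_crawl c (by omega)]
    split_ifs <;> omega
  have hsum := hc.sum_extendZero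
  rw [Finset.sum_range_succ'] at hsum
  have hsum_le := Finset.sum_le_sum hle
  by_contra! h
  have heq := (Finset.sum_eq_sum_iff_of_le hle).mp (by omega)
  have hzero : ∀ i ≤ m, ∀ s ≤ i, extendZero c s = 0 := by
    intro i
    induction i with
    | zero => intro _ s hs; rw [Nat.le_zero.mp hs]; omega
    | succ i ih =>
      intro hi s hs
      have ih := ih (by omega)
      rcases Nat.lt_or_eq_of_le hs with hs | rfl
      · exact ih s (by omega)
      have hex : excess c i = 0 := (excess_eq_zero_iff c i).mpr fun s hs => by simp [ih s hs]
      have := heq i (Finset.mem_range.mpr (by omega))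
      rw [extendZero_crawl c (by omega), if_pos hex] at this
      omega
  have : ∑ i ∈ Finset.range m, extendZero c (i + 1) = 0 := Finset.sum_eq_zero fun i hi => by
    rw [Finset.mem_range] at hi
    exact hzero m le_rfl (i + 1) (by omega)
  have := hzero m le_rfl 0 (by omega)
  omega

lemma Mmem.extendZero_crawl_eq_zero_iff (hc : Mmem n c) {i : ℕ} (hi : i + 1 < n) :
    extendZero (crawl n c) i = 0 ↔ excess c (i + 1) = 0 := by
  rw [extendZero_crawl c hi, excess_succ]
  split_ifs with h
  · omega
  · have : extendZero c (i + 1) ≠ 0 := fun h0 => h <| (excess_eq_zero_iff c i).mpr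
      fun s hs => by rw [hc.extendZero_eq_zero (by omega) hi h0]; omega
    omega

lemma Mmem.crawl (hn : 1 ≤ n) (hc : Mmem n c) : Mmem n (crawl n c) := by
  obtain ⟨m, rfl⟩ := Nat.exists_eq_add_of_le' hn
  have hlt := hc.sum_crawl_lt
  have hlast := extendZero_crawl_last m c
  refine ⟨?_, fun i j hij hj => ?_⟩
  · rw [← _root_.sum_extendZero, Finset.sum_range_succ]
    omega
  · rw [← extendZero_val (_root_.crawl (m + 1) c)] at hj ⊢
    have hjm : (j : ℕ) ≠ m := fun h => by rw [h] at hj; omega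
    have hjlt := j.2
    have hij : (i : ℕ) ≤ j := hij
    rw [hc.extendZero_crawl_eq_zero_iff (by omega)] at hj ⊢
    have := excess_monotone c (show (i : ℕ) + 1 ≤ j + 1 by omega)
    omega

lemma Mmem.excess_crawl (hc : Mmem n c) {i : ℕ} (hi : i + 1 < n) :
    excess (_root_.crawl n c) i = excess c (i + 1) - 1 := by
  have h0 := hc.excess_zero (by omega)
  induction i with
  | zero =>
    rw [excess_succ, h0, excess]
    simp [extendZero_crawl c hi, h0]
  | succ i ih =>
    rw [excess_succ, ih (by omega), extendZero_crawl c hi, excess_succ c (i + 1)]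
    split_ifs <;> omega

lemma Mmem.excess_crawl_last (hn : 1 ≤ n) (hc : Mmem n c) :
    excess (_root_.crawl n c) (n - 1) + 1 = countLE n (excess c) 0 := by
  rw [(hc.crawl hn).excess_last hn]
  obtain ⟨m, rfl⟩ := Nat.exists_eq_add_of_le' hn
  have hlt := hc.sum_crawl_lt
  have hlast := extendZero_crawl_last m c
  have h0 := hc.excess_zero hn
  unfold countLE
  rw [Finset.sum_range_succ, Finset.sum_range_succ', if_neg (by omega), if_pos h0.le, add_zero]
  congr 1
  refine Finset.sum_congr rfl fun i hi => ?_
  rw [Finset.mem_range] at hi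
  simp only [Nat.le_zero, hc.extendZero_crawl_eq_zero_iff (show i + 1 < m + 1 by omega)]

lemma Mmem.iterate_crawl (hn : 1 ≤ n) (hc : Mmem n c) (t : ℕ) : Mmem n ((_root_.crawl n)^[t] c) := by
  induction t with
  | zero => exact hc
  | succ t ih => rw [Function.iterate_succ_apply']; exact ih.crawl hn

lemma Mmem.excess_iterate_crawl (hn : 1 ≤ n) (hc : Mmem n c) {t : ℕ} (ht : t ≤ n) :
    ∀ i < n, excess ((_root_.crawl n)^[t] c) i = orbitProfile n (excess c) (i + t) - t := by
  induction t with
  | zero => intro i hi; simp [orbitProfile, hi]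
  | succ t ih =>
    have ih := ih (by omega)
    have hd := hc.iterate_crawl hn t
    intro i hi
    rw [Function.iterate_succ_apply']
    by_cases hi' : i + 1 < n
    · rw [hd.excess_crawl hi', ih _ hi', show i + 1 + t = i + (t + 1) by omega]
      omega
    · have hlast := hd.excess_crawl_last hn
      have hcount := countLE_orbitProfile (excess_monotone c) (fun i => hc.excess_eq_zero)
        (show t < n by omega)
      have hcongr : countLE n (excess ((_root_.crawl n)^[t] c)) 0 =
          countLE n (fun i => orbitProfile n (excess c) (i + t) - t) 0 :=
        Finset.sum_congr rfl fun i hi => by rw [ih i (Finset.mem_range.mp hi)]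
      obtain rfl : i = n - 1 := by omega
      rw [show n - 1 + (t + 1) = t + n by omega]
      simp only [orbitProfile, show ¬ t + n < n by omega, if_false, Nat.add_sub_cancel] at hcount hcongr ⊢
      omega

end Snake

/-- the crawl map sends `M_n` into `M_n`, and its `n`-th iterate is the
identity on `M_n`. -/
theorem stmt_19 (n : ℕ) (hn : 1 ≤ n) (c : Fin n → ℕ) (hc : Mmem n c) :
    Mmem n (crawl n c) ∧ (crawl n)^[n] c = c := by
  refine ⟨hc.crawl hn, (hc.iterate_crawl hn n).eq_of_excess_eq hc fun i hi => ?_⟩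
  rw [hc.excess_iterate_crawl hn le_rfl i hi]
  exact orbitProfile_add_sub (excess_monotone c) (fun i => hc.excess_eq_zero) i
end
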